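/- arXiv:2402.12014 — 2 statements merged into one kernel-verified Lean document; each statement's English description precedes it below -/
import Mathlib

section
/- Every 3-dicritical semi-complete digraph has at most 12·R_6(3) + 1 vertices, where R_6(3) is the smallest integer N such that every colouring of the edges of the complete graph on N vertices with 6 colours contains a monochromatic triangle. -/
/-- A (loopless, simple) digraph on vertex type `V`. -/
structure SimpleDigraph (V : Type) where
  Adj : V → V → Prop
  loopless : ∀ v, ¬ Adj v v

namespace SimpleDigraph

/-- A set of arcs (given as a relation) is acyclic if it admits no directed closed walk. -/
def AcyclicRel {V : Type} (A : V → V → Prop) : Prop :=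
  ∀ v, ¬ Relation.TransGen A v v

/-- A set of arcs is 2-dicolourable if the vertices can be coloured with two colours
so that each colour class induces an acyclic subdigraph. -/
def Dicolourable2Rel {V : Type} (A : V → V → Prop) : Prop :=
  ∃ φ : V → Fin 2, ∀ i : Fin 2,
    AcyclicRel (fun a b => A a b ∧ φ a = i ∧ φ b = i)

/-- A digraph is 2-dicolourable if its vertices can be coloured with two colours
so that each colour class induces an acyclic subdigraph. -/
def Dicolourable2 {V : Type} (D : SimpleDigraph V) : Prop :=
  Dicolourable2Rel D.Adj

/-- `(S, A)` describes a subdigraph of `D`: its vertex set is `S` and its arcs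
are given by `A`, which must join vertices of `S` and be arcs of `D`. -/
def IsSubdigraphOn {V : Type} (D : SimpleDigraph V) (S : Set V) (A : V → V → Prop) : Prop :=
  ∀ u v, A u v → u ∈ S ∧ v ∈ S ∧ D.Adj u v

/-- `D` is 3-dicritical: `D` is not 2-dicolourable, but every proper subdigraph of `D`
(one missing a vertex or an arc) is 2-dicolourable. -/
def Dicritical3 {V : Type} (D : SimpleDigraph V) : Prop :=
  ¬ D.Dicolourable2 ∧
    ∀ (S : Set V) (A : V → V → Prop), D.IsSubdigraphOn S A →
      (S ≠ Set.univ ∨ A ≠ D.Adj) → Dicolourable2Rel A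

/-- A digraph is semi-complete if any two distinct vertices are joined by at least one arc. -/
def SemiComplete {V : Type} (D : SimpleDigraph V) : Prop :=
  ∀ u v : V, u ≠ v → D.Adj u v ∨ D.Adj v u

/-- A tournament is a semi-complete digraph with no digon. -/
def IsTournament {V : Type} (D : SimpleDigraph V) : Prop :=
  D.SemiComplete ∧ ∀ u v : V, ¬ (D.Adj u v ∧ D.Adj v u)

/-- Isomorphism of digraphs. -/
def Iso {V W : Type} (D : SimpleDigraph V) (E : SimpleDigraph W) : Prop :=
  ∃ e : V ≃ W, ∀ u v : V, D.Adj u v ↔ E.Adj (e u) (e v)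

/-- `D` contains (a copy of) `H` as a subdigraph. -/
def ContainsSub {V W : Type} (D : SimpleDigraph V) (H : SimpleDigraph W) : Prop :=
  ∃ f : W → V, Function.Injective f ∧ ∀ a b, H.Adj a b → D.Adj (f a) (f b)

/-- `D` contains (a copy of) `H` as an induced subdigraph. -/
def ContainsInduced {V W : Type} (D : SimpleDigraph V) (H : SimpleDigraph W) : Prop :=
  ∃ f : W → V, Function.Injective f ∧ ∀ a b, H.Adj a b ↔ D.Adj (f a) (f b)

end SimpleDigraph

/-- `N` has the 6-colour triangle-Ramsey property: every 6-colouring of the edges of the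
complete graph on `N` vertices contains a monochromatic triangle. -/
def IsRamsey6Triangle (N : ℕ) : Prop :=
  ∀ c : Fin N → Fin N → Fin 6, (∀ i j, c i j = c j i) →
    ∃ a b d : Fin N, a ≠ b ∧ a ≠ d ∧ b ≠ d ∧ c a b = c a d ∧ c a b = c b d

/-- The local consequences of 3-dicriticality of a semi-complete digraph with arc relation `r`:
for every arc `(u, v)` there is a 2-colouring in which every monochromatic digon or directed
triangle uses `(u, v)`, and in which `(u, v)` becomes a backward arc of its colour class. -/
structure ArcCritical {V : Type} (r : V → V → Prop) : Prop where
  irrefl : ∀ v, ¬ r v v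
  total : ∀ u v, u ≠ v → r u v ∨ r v u
  exists_colouring : ∀ u v, r u v → ∃ φ : V → Fin 2, φ u = φ v ∧
    (∀ a b, φ a = φ b → r a b → r b a → (a = u ∧ b = v) ∨ (b = u ∧ a = v)) ∧
    (∀ a b c, φ a = φ b → φ b = φ c → r a b → r b c → r c a →
      (a = u ∧ b = v) ∨ (b = u ∧ c = v) ∨ (c = u ∧ a = v)) ∧
    (∀ z, φ z = φ u → r u z → r z v → False) ∧
    (¬ r v u → ∃ y, φ y = φ u ∧ r v y ∧ r y u)

namespace ArcCritical

variable {V : Type} {r : V → V → Prop}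

theorem reverse (h : ArcCritical r) : ArcCritical (fun a b => r b a) where
  irrefl := h.irrefl
  total u v huv := (h.total u v huv).symm
  exists_colouring u v huv := by
    obtain ⟨φ, h1, h2, h3, h4, h5⟩ := h.exists_colouring v u huv
    refine ⟨φ, h1.symm, ?_, ?_, ?_, ?_⟩
    · intro a b hab h h'
      have := h2 a b hab h' h
      tauto
    · intro a b c hab hbc h h' h''
      have := h3 c b a hbc.symm hab.symm h' h h''
      tauto
    · intro z hz h h'
      exact h4 z (hz.trans h1.symm) h' h
    · intro hn
      obtain ⟨y, hy, h, h'⟩ := h5 hn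
      exact ⟨y, hy.trans h1, h', h⟩

/-- No directed triangle lies between the tail and the head of an arc. -/
theorem no_triangle_between (h : ArcCritical r) {u v a b c : V} (huv : r u v)
    (hab : r a b) (hbc : r b c) (hca : r c a)
    (ua : r u a) (ub : r u b) (uc : r u c) (av : r a v) (bv : r b v) (cv : r c v) : False := by
  obtain ⟨φ, h1, h2, h3, h4, h5⟩ := h.exists_colouring u v huv
  have ha : φ a ≠ φ u := fun e => h4 a e ua av
  have hb : φ b ≠ φ u := fun e => h4 b e ub bv
  have hc : φ c ≠ φ u := fun e => h4 c e uc cv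
  rcases h3 a b c (by omega) (by omega) hab hbc hca with e | e | e
  · exact ha (by rw [e.1])
  · exact hb (by rw [e.1])
  · exact hc (by rw [e.1])

/-- Three ordered triangles `p → q → y → p` whose apices form a transitive triangle and lie
backwards between the `q` and the `p` of every earlier triangle yield a contradiction. -/
theorem no_interleaved_triple (h : ArcCritical r) {pᵢ yᵢ qⱼ yⱼ pₖ qₖ yₖ : V}
    (qyj : r qⱼ yⱼ) (ypi : r yᵢ pᵢ) (pqk : r pₖ qₖ) (qyk : r qₖ yₖ) (ypk : r yₖ pₖ)
    (pqij : r pᵢ qⱼ) (ppik : r pᵢ pₖ) (qpjk : r qⱼ pₖ) (qqjk : r qⱼ qₖ)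
    (pyki : r pₖ yᵢ) (qyji : r qⱼ yᵢ) (pykj : r pₖ yⱼ) (qykj : r qₖ yⱼ)
    (yyij : r yᵢ yⱼ) (yyjk : r yⱼ yₖ) (ypki : r yₖ pᵢ) (qyjk : r qⱼ yₖ) : False := by
  obtain ⟨φ, h1, h2, h3, h4, h5⟩ := h.exists_colouring qⱼ yⱼ qyj
  have hyi : φ yᵢ ≠ φ qⱼ := fun e => h4 _ e qyji yyij
  have hpk : φ pₖ ≠ φ qⱼ := fun e => h4 _ e qpjk pykj
  have hqk : φ qₖ ≠ φ qⱼ := fun e => h4 _ e qqjk qykj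
  have hyk : φ yₖ = φ qⱼ := by
    by_contra hne
    rcases h3 pₖ qₖ yₖ (by omega) (by omega) pqk qyk ypk with e | e | e
    · exact hpk (by rw [e.1])
    · exact hqk (by rw [e.1])
    · exact hne (by rw [e.1])
  by_cases hpi : φ pᵢ = φ qⱼ
  · rcases h3 pᵢ qⱼ yₖ hpi hyk.symm pqij qyjk ypki with e | e | e
    · exact h.irrefl _ (e.1 ▸ pqij)
    · exact h.irrefl _ (e.2 ▸ yyjk)
    · exact h.irrefl _ (e.1 ▸ qyjk)
  · rcases h3 yᵢ pᵢ pₖ (by omega) (by omega) ypi ppik pyki with e | e | e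
    · exact hyi (by rw [e.1])
    · exact hpi (by rw [e.1])
    · exact hpk (by rw [e.1])

/-- The relative position of a triangle `p → q → y → p` and the apex `y'` of a later triangle. -/
theorem apex_position (h : ArcCritical r) {p q y p' q' y' : V} {φ : V → Fin 2}
    (h2 : ∀ a b, φ a = φ b → r a b → r b a → (a = p ∧ b = q) ∨ (b = p ∧ a = q))
    (h3 : ∀ a b c, φ a = φ b → φ b = φ c → r a b → r b c → r c a →
      (a = p ∧ b = q) ∨ (b = p ∧ c = q) ∨ (c = p ∧ a = q))
    (hφq : φ p = φ q) (hφy : φ y = φ p)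
    (qy : r q y) (yp : r y p) (pq' : r p' q') (qy' : r q' y') (yp' : r y' p')
    (pp : r p p') (pq : r p q') (qp : r q p') (qq : r q q') (nqp : ¬ r q' p) (nqq : ¬ r q' q)
    (py : r p' y) (qy'' : r q' y) (nyp : ¬ r y p') :
    (r y' p ∧ r y' q ∧ r y' y) ∨ (r p y' ∧ r q y' ∧ r y y') ∨
      (r q y' ∧ r y' p ∧ r y' y) ∨ (r q y' ∧ r y' p ∧ r y y') := by
  have hirr := h.irrefl
  have hyq : y ≠ q := by rintro rfl; exact hirr _ qy
  have hyp : y ≠ p := by rintro rfl; exact hirr _ yp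
  have hp'p : p' ≠ p := by rintro rfl; exact hirr _ pp
  have hq'p : q' ≠ p := by rintro rfl; exact hirr _ pq
  have hp'q : p' ≠ q := by rintro rfl; exact hirr _ qp
  have hq'q : q' ≠ q := by rintro rfl; exact hirr _ qq
  have hy'p : y' ≠ p := by rintro rfl; exact nqp qy'
  have hy'q : y' ≠ q := by rintro rfl; exact nqq qy'
  have hy'y : y' ≠ y := by rintro rfl; exact nyp yp'
  have cp : φ p' ≠ φ p := by
    intro e
    have := h3 p' y p (by omega) hφy py yp pp
    tauto
  have cq : φ q' ≠ φ p := by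
    intro e
    have := h3 q' y p (by omega) hφy qy'' yp pq
    tauto
  have cy : φ y' = φ p := by
    by_contra hne
    have := h3 p' q' y' (by omega) (by omega) pq' qy' yp'
    tauto
  have tp := h.total y' p hy'p
  have tq := h.total y' q hy'q
  have ty := h.total y' y hy'y
  have a1 : ¬ (r y' q ∧ r y y') := by
    rintro ⟨s, t⟩
    have := h3 y y' q (by omega) (by omega) t s qy
    tauto
  have a2 : ¬ (r p y' ∧ r y' y) := by
    rintro ⟨s, t⟩
    have := h3 p y' y (by omega) (by omega) s t yp
    tauto
  tauto

end ArcCritical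

theorem IsRamsey6Triangle.exists_lt_lt {N : ℕ} (hN : IsRamsey6Triangle N)
    (P : Fin 6 → Fin N → Fin N → Prop) (hP : ∀ i j, i < j → ∃ t, P t i j) :
    ∃ t i j k, i < j ∧ j < k ∧ P t i j ∧ P t i k ∧ P t j k := by
  classical
  choose! f hf using hP
  obtain ⟨a, b, d, hab, had, hbd, h1, h2⟩ := hN (fun i j => f (min i j) (max i j))
    (fun i j => by rw [min_comm, max_comm])
  have key : ∀ i j k, i < j → j < k → f i j = f i k → f i j = f j k →
      ∃ t i j k, i < j ∧ j < k ∧ P t i j ∧ P t i k ∧ P t j k := fun i j k hij hjk e1 e2 =>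
    ⟨f i j, i, j, k, hij, hjk, hf i j hij, e1 ▸ hf i k (hij.trans hjk), e2 ▸ hf j k hjk⟩
  rcases lt_or_gt_of_ne hab with x | x <;> rcases lt_or_gt_of_ne had with y | y <;>
    rcases lt_or_gt_of_ne hbd with z | z <;>
    simp only [min_eq_left x.le, min_eq_left y.le, min_eq_left z.le, min_eq_right x.le,
      min_eq_right y.le, min_eq_right z.le, max_eq_left x.le, max_eq_left y.le, max_eq_left z.le,
      max_eq_right x.le, max_eq_right y.le, max_eq_right z.le] at h1 h2
  · exact key a b d x z h1 h2
  · exact key a d b y z h1.symm (h1.symm.trans h2)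
  · exact absurd (x.trans z) y.asymm
  · exact key d a b y x (h1.symm.trans h2) h1.symm
  · exact key b a d x y h2 h1
  · exact absurd (y.trans z) x.asymm
  · exact key b d a z y (h2.symm) (h2.symm.trans h1)
  · exact key d b a z x (h2.symm.trans h1) h2.symm

theorem exists_mono_triangle_of_card_le (k : ℕ) : ∃ N : ℕ, ∀ (V : Type) (S : Finset V)
    (K : Finset (Fin 6)) (c : V → V → Fin 6), (∀ i j, c i j = c j i) → K.card ≤ k →
    N ≤ S.card → (∀ i ∈ S, ∀ j ∈ S, i ≠ j → c i j ∈ K) →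
    ∃ a b d : V, a ≠ b ∧ a ≠ d ∧ b ≠ d ∧ c a b = c a d ∧ c a b = c b d := by
  classical
  induction k with
  | zero =>
    refine ⟨2, fun V S K c _ hK hS hc => ?_⟩
    obtain ⟨i, hi, j, hj, hij⟩ := Finset.one_lt_card.1 hS
    have := hc i hi j hj hij
    simp_all
  | succ k ih =>
    obtain ⟨N, hN⟩ := ih
    refine ⟨6 * N + 2, fun V S K c hsymm hK hS hc => ?_⟩
    obtain ⟨v, hv⟩ : S.Nonempty := Finset.card_pos.1 (by omega)
    have hcard := Finset.card_erase_of_mem hv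
    obtain ⟨t, -, ht⟩ := Finset.exists_lt_card_fiber_of_mul_lt_card_of_maps_to
      (s := S.erase v) (t := Finset.univ) (f := c v) (n := N) (fun _ _ => Finset.mem_univ _)
      (by simp only [Finset.card_univ, Fintype.card_fin]; omega)
    set T := {x ∈ S.erase v | c v x = t} with hT
    have hmem : ∀ x ∈ T, x ≠ v ∧ x ∈ S ∧ c v x = t := fun x hx => by
      simpa [hT, and_assoc] using hx
    by_cases hex : ∃ i ∈ T, ∃ j ∈ T, i ≠ j ∧ c i j = t
    · obtain ⟨i, hi, j, hj, hij, e⟩ := hex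
      obtain ⟨hi1, -, hi3⟩ := hmem i hi
      obtain ⟨hj1, -, hj3⟩ := hmem j hj
      exact ⟨v, i, j, hi1.symm, hj1.symm, hij, hi3.trans hj3.symm, hi3.trans e.symm⟩
    · push Not at hex
      obtain ⟨w, hw⟩ : T.Nonempty := Finset.card_pos.1 (by omega)
      obtain ⟨hw1, hw2, hw3⟩ := hmem w hw
      have htK : t ∈ K := hw3 ▸ hc v hv w hw2 hw1.symm
      refine hN V T (K.erase t) c hsymm ?_ ht.le fun i hi j hj hij => ?_
      · rw [Finset.card_erase_of_mem htK]
        omega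
      · exact Finset.mem_erase.2 ⟨hex i hi j hj hij,
          hc i (hmem i hi).2.1 j (hmem j hj).2.1 hij⟩

theorem exists_isRamsey6Triangle : ∃ N, IsRamsey6Triangle N := by
  obtain ⟨N, hN⟩ := exists_mono_triangle_of_card_le 6
  refine ⟨N, fun c hc => hN (Fin N) Finset.univ Finset.univ c hc ?_ ?_ ?_⟩ <;> simp

namespace ArcCritical

variable {V : Type} {r : V → V → Prop}

/-- In a sequence of triangles `p i → q i → y i → p i` on a transitive tournament, whose apices
are dominated by all later arcs `(p k, q k)`, the length is not a Ramsey number. -/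
theorem not_isRamsey_of_dominated (h : ArcCritical r) {N : ℕ} (p q y : Fin N → V)
    (φ : Fin N → V → Fin 2)
    (h2 : ∀ i a b, φ i a = φ i b → r a b → r b a → (a = p i ∧ b = q i) ∨ (b = p i ∧ a = q i))
    (h3 : ∀ i a b c, φ i a = φ i b → φ i b = φ i c → r a b → r b c → r c a →
      (a = p i ∧ b = q i) ∨ (b = p i ∧ c = q i) ∨ (c = p i ∧ a = q i))
    (hφq : ∀ i, φ i (p i) = φ i (q i)) (hφy : ∀ i, φ i (y i) = φ i (p i))
    (pq : ∀ i, r (p i) (q i)) (qy : ∀ i, r (q i) (y i)) (yp : ∀ i, r (y i) (p i))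
    (hlt : ∀ i j, i < j → (r (p i) (p j) ∧ r (p i) (q j) ∧ r (q i) (p j) ∧ r (q i) (q j)) ∧
      ¬ r (q j) (p i) ∧ ¬ r (q j) (q i))
    (hdom : ∀ i j, i < j → r (p j) (y i) ∧ r (q j) (y i) ∧ ¬ r (y i) (p j)) :
    ¬ IsRamsey6Triangle N := by
  intro hN
  obtain ⟨t, i, j, k, hij, hjk, e1, e2, e3⟩ := hN.exists_lt_lt
    (fun t i j =>
      (t = 0 ∧ r (y j) (p i) ∧ r (y j) (q i) ∧ r (y j) (y i)) ∨
      (t = 1 ∧ r (p i) (y j) ∧ r (q i) (y j) ∧ r (y i) (y j)) ∨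
      (t = 2 ∧ r (q i) (y j) ∧ r (y j) (p i) ∧ r (y j) (y i)) ∨
      (t = 3 ∧ r (q i) (y j) ∧ r (y j) (p i) ∧ r (y i) (y j)))
    (fun i j hij => by
      obtain ⟨⟨a1, a2, a3, a4⟩, a5, a6⟩ := hlt i j hij
      obtain ⟨b1, b2, b3⟩ := hdom i j hij
      rcases h.apex_position (h2 i) (h3 i) (hφq i) (hφy i) (qy i) (yp i) (pq j) (qy j) (yp j)
        a1 a2 a3 a4 a5 a6 b1 b2 b3 with c | c | c | c
      · exact ⟨0, Or.inl ⟨rfl, c⟩⟩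
      · exact ⟨1, Or.inr (Or.inl ⟨rfl, c⟩)⟩
      · exact ⟨2, Or.inr (Or.inr (Or.inl ⟨rfl, c⟩))⟩
      · exact ⟨3, Or.inr (Or.inr (Or.inr ⟨rfl, c⟩))⟩)
  have lij := (hlt i j hij).1
  have ljk := (hlt j k hjk).1
  have lik := (hlt i k (hij.trans hjk)).1
  have dij := hdom i j hij
  have djk := hdom j k hjk
  have dik := hdom i k (hij.trans hjk)
  rcases e1 with ⟨rfl, e1⟩ | ⟨rfl, e1⟩ | ⟨rfl, e1⟩ | ⟨rfl, e1⟩ <;>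
    simp only [Fin.isValue, Fin.reduceEq, true_and, false_and, or_false, false_or] at e2 e3
  · exact h.no_triangle_between e2.2.2 (pq j) (qy j) (yp j) e3.1 e3.2.1 e3.2.2
      dij.1 dij.2.1 e1.2.2
  · exact h.no_triangle_between e2.1 (pq j) (qy j) (yp j) lij.1 lij.2.1 e1.1
      e3.1 e3.2.1 e3.2.2
  · exact h.no_triangle_between (qy i) (pq j) (qy j) (yp j) lij.2.2.1 lij.2.2.2 e1.1
      dij.1 dij.2.1 e1.2.2
  · exact h.no_interleaved_triple (qy j) (yp i) (pq k) (qy k) (yp k) lij.2.1 lik.1 ljk.2.2.1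
      ljk.2.2.2 dik.1 dij.2.1 djk.1 djk.2.1 e1.2.2 e3.2.2 e2.2.1 e3.1

/-- If an arc-critical semi-complete digraph contains a transitive tournament on `4 * N` vertices,
then `N` is not a Ramsey number. -/
theorem not_isRamsey_of_transitive (h : ArcCritical r) {N : ℕ} (a : Fin (2 * (2 * N)) → V)
    (ha : ∀ i j, i < j → r (a i) (a j) ∧ ¬ r (a j) (a i)) : ¬ IsRamsey6Triangle N := by
  classical
  intro hN
  obtain ⟨p, hp⟩ : ∃ p : Fin (2 * N) → V, ∀ i, p i = a ⟨2 * i, by omega⟩ := ⟨_, fun _ => rfl⟩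
  obtain ⟨q, hq⟩ : ∃ q : Fin (2 * N) → V, ∀ i, q i = a ⟨2 * i + 1, by omega⟩ :=
    ⟨_, fun _ => rfl⟩
  have pq : ∀ i, r (p i) (q i) ∧ ¬ r (q i) (p i) := fun i => by
    rw [hp, hq]; exact ha _ _ (by simp [Fin.lt_def])
  have pp : ∀ i j, i < j → r (p i) (p j) ∧ ¬ r (p j) (p i) := fun i j hij => by
    rw [hp, hp]; exact ha _ _ (by simp only [Fin.lt_def] at *; omega)
  have pq' : ∀ i j, i < j → r (p i) (q j) ∧ ¬ r (q j) (p i) := fun i j hij => by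
    rw [hp, hq]; exact ha _ _ (by simp only [Fin.lt_def] at *; omega)
  have qp : ∀ i j, i < j → r (q i) (p j) ∧ ¬ r (p j) (q i) := fun i j hij => by
    rw [hp, hq]; exact ha _ _ (by simp only [Fin.lt_def] at *; omega)
  have qq : ∀ i j, i < j → r (q i) (q j) ∧ ¬ r (q j) (q i) := fun i j hij => by
    rw [hq, hq]; exact ha _ _ (by simp only [Fin.lt_def] at *; omega)
  choose φ h1 h2 h3 _ h5 using fun i => h.exists_colouring _ _ (pq i).1
  choose y hφy qy yp using fun i => h5 i (pq i).2
  have hne : ∀ i j, i < j → p i ≠ y j ∧ q i ≠ y j := fun i j hij =>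
    ⟨fun e => (pq' i j hij).2 (e ▸ qy j), fun e => (qq i j hij).2 (e ▸ qy j)⟩
  have hne' : ∀ i j, i < j → p j ≠ y i ∧ q j ≠ y i := fun i j hij =>
    ⟨fun e => (pp i j hij).2 (e ▸ yp i), fun e => (pq' i j hij).2 (e ▸ yp i)⟩
  have hdich : ∀ j, (∀ i, i < j → ¬ r (p i) (y j) ∧ ¬ r (q i) (y j)) ∨
      (∀ k, j < k → ¬ r (y j) (p k) ∧ ¬ r (y j) (q k)) := by
    intro j
    by_contra hcon
    rw [not_or] at hcon
    obtain ⟨c1, c2⟩ := hcon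
    push Not at c1 c2
    obtain ⟨i, hij, c1⟩ := c1
    obtain ⟨k, hjk, c2⟩ := c2
    have hik := hij.trans hjk
    have key : ∀ u v, (u = p i ∨ u = q i) → (v = p k ∨ v = q k) → r u (y j) → r (y j) v →
        False := by
      intro u v hu hv huy hyv
      have huv : r u v ∧ r u (p j) ∧ r u (q j) ∧ r (p j) v ∧ r (q j) v := by
        have := (pp i k hik).1
        have := (pq' i k hik).1
        have := (qp i k hik).1
        have := (qq i k hik).1
        have := (pp i j hij).1
        have := (pq' i j hij).1
        have := (qp i j hij).1
        have := (qq i j hij).1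
        have := (pp j k hjk).1
        have := (pq' j k hjk).1
        have := (qp j k hjk).1
        have := (qq j k hjk).1
        rcases hu with rfl | rfl <;> rcases hv with rfl | rfl <;>
          (refine ⟨?_, ?_, ?_, ?_, ?_⟩ <;> assumption)
      exact h.no_triangle_between huv.1 (pq j).1 (qy j) (yp j) huv.2.1 huv.2.2.1 huy
        huv.2.2.2.1 huv.2.2.2.2 hyv
    by_cases d1 : r (p i) (y j) <;> by_cases d2 : r (y j) (p k)
    · exact key _ _ (Or.inl rfl) (Or.inl rfl) d1 d2
    · exact key _ _ (Or.inl rfl) (Or.inr rfl) d1 (c2 d2)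
    · exact key _ _ (Or.inr rfl) (Or.inl rfl) (c1 d1) d2
    · exact key _ _ (Or.inr rfl) (Or.inr rfl) (c1 d1) (c2 d2)
  set S : Finset (Fin (2 * N)) :=
    {j | ∀ k, j < k → ¬ r (y j) (p k) ∧ ¬ r (y j) (q k)} with hS
  have hcard := Finset.card_add_card_compl S
  rw [Fintype.card_fin] at hcard
  rcases le_total N S.card with hle | hle
  · let e := S.orderEmbOfCardLe hle
    have he : ∀ i, e i ∈ S := fun i => S.orderEmbOfCardLe_mem hle i
    have elt : ∀ i j, i < j → e i < e j := fun i j hij => e.strictMono hij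
    refine h.not_isRamsey_of_dominated (p ∘ e) (q ∘ e) (y ∘ e) (φ ∘ e) (fun i => h2 (e i))
      (fun i => h3 (e i)) (fun i => h1 (e i)) (fun i => hφy (e i)) (fun i => (pq (e i)).1)
      (fun i => qy (e i)) (fun i => yp (e i)) ?_ ?_ hN
    · intro i j hij
      have hij := elt i j hij
      exact ⟨⟨(pp _ _ hij).1, (pq' _ _ hij).1, (qp _ _ hij).1, (qq _ _ hij).1⟩,
        (pq' _ _ hij).2, (qq _ _ hij).2⟩
    · intro i j hij
      have hij := elt i j hij
      have hi := he i
      simp only [hS, Finset.mem_filter_univ] at hi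
      have hi := hi _ hij
      have := hne' _ _ hij
      exact ⟨(h.total _ _ this.1).resolve_right hi.1, (h.total _ _ this.2).resolve_right hi.2,
        hi.1⟩
  · have hle' : N ≤ Sᶜ.card := by omega
    let e := fun i : Fin N => Sᶜ.orderEmbOfCardLe hle' i.rev
    have he : ∀ i, e i ∈ Sᶜ := fun i => Sᶜ.orderEmbOfCardLe_mem hle' _
    have elt : ∀ i j, i < j → e j < e i := fun i j hij =>
      (Sᶜ.orderEmbOfCardLe hle').strictMono (Fin.rev_lt_rev.2 hij)
    have g1 := fun i => (h1 i).symm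
    refine h.reverse.not_isRamsey_of_dominated (q ∘ e) (p ∘ e) (y ∘ e) (φ ∘ e) ?_
      ?_ (fun i => g1 (e i)) (fun i => (hφy (e i)).trans (h1 (e i))) (fun i => (pq (e i)).1)
      (fun i => yp (e i)) (fun i => qy (e i)) ?_ ?_ hN
    · intro i a b hab s t
      have := h2 (e i) a b hab t s
      simp only [Function.comp_apply]
      tauto
    · intro i a b c hab hbc s t u
      have := h3 (e i) c b a hbc.symm hab.symm t s u
      simp only [Function.comp_apply]
      tauto
    · intro i j hij
      have hij := elt i j hij
      exact ⟨⟨(qq _ _ hij).1, (pq' _ _ hij).1, (qp _ _ hij).1, (pp _ _ hij).1⟩,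
        (pq' _ _ hij).2, (pp _ _ hij).2⟩
    · intro i j hij
      have hij := elt i j hij
      have hi := he i
      simp only [hS, Finset.mem_compl, Finset.mem_filter_univ] at hi
      have hi := (hdich (e i)).resolve_right hi _ hij
      have := hne _ _ hij
      exact ⟨(h.total _ _ this.2).resolve_left hi.2, (h.total _ _ this.1).resolve_left hi.1,
        hi.2⟩

end ArcCritical

theorem exists_transitive_enumeration {V : Type} {r : V → V → Prop} (S : Finset V)
    (total : ∀ u v, u ≠ v → r u v ∨ r v u)
    (hdig : ∀ a ∈ S, ∀ b ∈ S, r a b → ¬ r b a)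
    (htri : ∀ a ∈ S, ∀ b ∈ S, ∀ c ∈ S, r a b → r b c → ¬ r c a) {n : ℕ} (hn : n ≤ S.card) :
    ∃ f : Fin n → V, ∀ i j, i < j → r (f i) (f j) ∧ ¬ r (f j) (f i) := by
  classical
  let _ : LinearOrder S :=
    { le := fun a b => a = b ∨ r a b
      le_refl := fun a => Or.inl rfl
      le_trans := by
        rintro a b c (rfl | h1) (rfl | h2)
        · exact Or.inl rfl
        · exact Or.inr h2
        · exact Or.inr h1
        · by_cases hac : a = c
          · exact Or.inl hac
          · exact Or.inr ((total a c (fun e => hac (Subtype.ext e))).resolve_right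
              (htri _ a.2 _ b.2 _ c.2 h1 h2))
      le_antisymm := by
        rintro a b (rfl | h1) (h2 | h2)
        · rfl
        · rfl
        · exact h2.symm
        · exact absurd h2 (hdig _ a.2 _ b.2 h1)
      le_total := by
        intro a b
        by_cases hab : a = b
        · exact Or.inl (Or.inl hab)
        · exact (total a b (fun e => hab (Subtype.ext e))).imp Or.inr Or.inr
      toDecidableLE := Classical.decRel _ }
  have hcard : n ≤ (Finset.univ : Finset S).card := by simpa using hn
  let e := (Finset.univ : Finset S).orderEmbOfCardLe hcard
  refine ⟨fun i => e i, fun i j hij => ?_⟩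
  have hlt : e i < e j := e.strictMono hij
  have hr : r (e i) (e j) := by
    rcases hlt.le with h | h
    · exact absurd h hlt.ne
    · exact h
  exact ⟨hr, hdig _ (e i).2 _ (e j).2 hr⟩

theorem SimpleDigraph.Dicritical3.arcCritical {V : Type} {D : SimpleDigraph V}
    (hD : D.Dicritical3) (hs : D.SemiComplete) : ArcCritical D.Adj where
  irrefl := D.loopless
  total := hs
  exists_colouring u v huv := by
    classical
    obtain ⟨φ, hφ⟩ := hD.2 Set.univ (fun a b => D.Adj a b ∧ ¬ (a = u ∧ b = v))
      (fun a b hab => ⟨trivial, trivial, hab.1⟩)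
      (Or.inr fun e => (congrFun₂ e u v).mpr huv |>.2 ⟨rfl, rfl⟩)
    have hE : ∀ {a b}, φ a = φ b → D.Adj a b → ¬ (a = u ∧ b = v) → Relation.TransGen
        (fun a b => (D.Adj a b ∧ ¬ (a = u ∧ b = v)) ∧ φ a = φ b) a b :=
      fun e h h' => .single ⟨⟨h, h'⟩, e⟩
    have hacyc : ∀ w, ¬ Relation.TransGen
        (fun a b => (D.Adj a b ∧ ¬ (a = u ∧ b = v)) ∧ φ a = φ b) w w := by
      intro w hw
      have key : ∀ b, Relation.TransGen
          (fun a b => (D.Adj a b ∧ ¬ (a = u ∧ b = v)) ∧ φ a = φ b) w b →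
          φ b = φ w ∧ Relation.TransGen
          (fun a b => (D.Adj a b ∧ ¬ (a = u ∧ b = v)) ∧ φ a = φ w ∧ φ b = φ w) w b := by
        intro b hb
        induction hb with
        | single h => exact ⟨h.2.symm, .single ⟨h.1, rfl, h.2.symm⟩⟩
        | tail _ h ih => exact ⟨h.2.symm.trans ih.1, ih.2.tail ⟨h.1, ih.1, h.2.symm.trans ih.1⟩⟩
      exact hφ (φ w) w (key w hw).2
    obtain ⟨hφuv, hpath⟩ : φ u = φ v ∧ Relation.TransGen
        (fun a b => (D.Adj a b ∧ ¬ (a = u ∧ b = v)) ∧ φ a = φ b) v u := by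
      by_contra hcon
      refine hD.1 ⟨φ, fun i w hw => ?_⟩
      have key : ∀ b, Relation.TransGen (fun a b => D.Adj a b ∧ φ a = i ∧ φ b = i) w b →
          Relation.TransGen (fun a b => (D.Adj a b ∧ ¬ (a = u ∧ b = v)) ∧ φ a = φ b) w b ∨
          (φ u = φ v ∧ Relation.ReflTransGen
            (fun a b => (D.Adj a b ∧ ¬ (a = u ∧ b = v)) ∧ φ a = φ b) w u ∧
            Relation.ReflTransGen
            (fun a b => (D.Adj a b ∧ ¬ (a = u ∧ b = v)) ∧ φ a = φ b) v b) := by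
        intro b hb
        induction hb with
        | @single b h =>
          by_cases e : w = u ∧ b = v
          · obtain ⟨rfl, rfl⟩ := e
            exact Or.inr ⟨h.2.1.trans h.2.2.symm, .refl, .refl⟩
          · exact Or.inl (hE (h.2.1.trans h.2.2.symm) h.1 e)
        | @tail b c _ h ih =>
          by_cases e : b = u ∧ c = v
          · obtain ⟨rfl, rfl⟩ := e
            refine Or.inr ⟨h.2.1.trans h.2.2.symm, ?_, .refl⟩
            rcases ih with ih | ih
            · exact ih.to_reflTransGen
            · exact ih.2.1
          · have hbc := hE (h.2.1.trans h.2.2.symm) h.1 e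
            rcases ih with ih | ih
            · exact Or.inl (ih.trans hbc)
            · exact Or.inr ⟨ih.1, ih.2.1, ih.2.2.trans hbc.to_reflTransGen⟩
      rcases key w hw with h | ⟨h, h', h''⟩
      · exact hacyc w h
      · rcases Relation.reflTransGen_iff_eq_or_transGen.1 (h''.trans h') with h3 | h3
        · exact D.loopless u (by rw [← h3] at huv; exact huv)
        · exact hcon ⟨h, h3⟩
    refine ⟨φ, hφuv, ?_, ?_, ?_, ?_⟩
    · intro a b hab h h'
      by_contra hcon
      rw [not_or] at hcon
      exact hacyc a ((hE hab h hcon.1).trans (hE hab.symm h' hcon.2))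
    · intro a b c hab hbc h h' h''
      by_contra hcon
      rw [not_or, not_or] at hcon
      exact hacyc a (((hE hab h hcon.1).trans (hE hbc h' hcon.2.1)).trans
        (hE (hbc.symm.trans hab.symm) h'' hcon.2.2))
    · intro z hz h h'
      refine hacyc v ((hpath.trans (hE hz.symm h ?_)).trans (hE (hz.trans hφuv) h' ?_))
      · rintro ⟨-, rfl⟩
        exact D.loopless _ h'
      · rintro ⟨rfl, -⟩
        exact D.loopless _ h
    · intro hvu
      obtain ⟨w, hvw, hwu⟩ := Relation.TransGen.head'_iff.1 hpath
      have hne : w ≠ u := by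
        rintro rfl
        exact hvu hvw.1.1
      have hcol : φ w = φ u := hvw.2.symm.trans hφuv.symm
      refine ⟨w, hcol, hvw.1.1, (hs w u hne).resolve_right fun huw => ?_⟩
      refine hacyc w (Relation.TransGen.trans_right hwu (hE hcol.symm huw ?_))
      rintro ⟨-, rfl⟩
      exact D.loopless _ hvw.1.1

/-- Every 3-dicritical semi-complete digraph has at most
`12 · R_6(3) + 1` vertices, where `R_6(3)` is the least `N` such that every 6-colouring
of the edges of `K_N` contains a monochromatic triangle. -/
theorem card_dicritical3_semicomplete_le_ramsey :
    ∀ (V : Type) [Fintype V] (D : SimpleDigraph V),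
      D.SemiComplete → D.Dicritical3 →
        Fintype.card V ≤ 12 * sInf {N : ℕ | IsRamsey6Triangle N} + 1 := by
  classical
  intro V _ D hs hD
  have hN : IsRamsey6Triangle (sInf {N : ℕ | IsRamsey6Triangle N}) :=
    Nat.sInf_mem exists_isRamsey6Triangle
  set N := sInf {N : ℕ | IsRamsey6Triangle N}
  by_contra hcard
  push Not at hcard
  obtain ⟨x⟩ : Nonempty V := Fintype.card_pos_iff.1 (by omega)
  obtain ⟨φ, hφ⟩ := hD.2 {x}ᶜ (fun a b => D.Adj a b ∧ a ≠ x ∧ b ≠ x)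
    (fun a b h => ⟨h.2.1, h.2.2, h.1⟩)
    (Or.inl fun e => (e ▸ Set.mem_univ x : x ∈ ({x}ᶜ : Set V)) rfl)
  obtain ⟨i, -, hi⟩ := Finset.exists_lt_card_fiber_of_mul_lt_card_of_maps_to
    (s := Finset.univ.erase x) (t := Finset.univ) (f := φ) (n := 4 * N)
    (fun _ _ => Finset.mem_univ _)
    (by
      rw [Finset.card_erase_of_mem (Finset.mem_univ x)]
      simp only [Finset.card_univ, Fintype.card_fin]
      omega)
  have hE : ∀ a ∈ {v ∈ Finset.univ.erase x | φ v = i}, ∀ b ∈ {v ∈ Finset.univ.erase x | φ v = i},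
      D.Adj a b → Relation.TransGen
        (fun a b => (D.Adj a b ∧ a ≠ x ∧ b ≠ x) ∧ φ a = i ∧ φ b = i) a b := by
    intro a ha b hb hab
    simp only [Finset.mem_filter, Finset.mem_erase, Finset.mem_univ, and_true] at ha hb
    exact .single ⟨⟨hab, ha.1, hb.1⟩, ha.2, hb.2⟩
  obtain ⟨f, hf⟩ := exists_transitive_enumeration (r := D.Adj) (n := 2 * (2 * N)) _ hs
    (fun a ha b hb h h' => hφ i a ((hE a ha b hb h).trans (hE b hb a ha h')))
    (fun a ha b hb c hc h h' h'' =>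
      hφ i a (((hE a ha b hb h).trans (hE b hb c hc h')).trans (hE c hc a ha h'')))
    (by omega : 2 * (2 * N) ≤ _)
  exact (hD.arcCritical hs).not_isRamsey_of_transitive f hf hN
end

section
/- A semi-complete digraph D is 3-dicritical if and only if D is isomorphic to one of the following eight digraphs: the bidirected complete graph on 3 vertices ↔K3; the directed wheel W3; the digraph H5; the rotative digraphs R(H1,H2) for H1,H2 ∈ {↔K2, C3} (four digraphs); and the Paley tournament P7 on seven vertices. -/
/-- An auxiliary constructor: the digraph on `Fin n` whose arcs are the pairs in `l`. -/
def digraphOfPairs (n : ℕ) (l : List (ℕ × ℕ)) (h : ∀ v : Fin n, (v.val, v.val) ∉ l) :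
    SimpleDigraph (Fin n) :=
  ⟨fun u v => (u.val, v.val) ∈ l, h⟩

/-- The bidirected complete graph `↔K2` on two vertices (a digon). -/
def biK2 : SimpleDigraph (Fin 2) :=
  ⟨fun u v => u ≠ v, fun v h => h rfl⟩

/-- The bidirected complete graph `↔K3` on three vertices. -/
def biK3 : SimpleDigraph (Fin 3) :=
  ⟨fun u v => u ≠ v, fun v h => h rfl⟩

/-- The directed cycle `C3` on three vertices. -/
def dirC3 : SimpleDigraph (Fin 3) :=
  ⟨fun u v => v = u + 1, by decide⟩

/-- The directed wheel `W3`: a directed triangle `0 → 1 → 2 → 0` together with a hub `3`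
joined by a digon to each triangle vertex. -/
def dirW3 : SimpleDigraph (Fin 4) :=
  digraphOfPairs 4 [(3,0),(0,3),(3,1),(1,3),(3,2),(2,3),(0,1),(1,2),(2,0)] (by decide)

/-- The digraph `H5` on vertices `u0, …, u4`: digons between `u0,u1` and between `u0,u4`,
and simple arcs `u4u1, u1u3, u1u2, u3u4, u2u4, u3u0, u0u2, u2u3`. -/
def digraphH5 : SimpleDigraph (Fin 5) :=
  digraphOfPairs 5 [(0,1),(1,0),(0,4),(4,0),(4,1),(1,3),(1,2),(3,4),(2,4),(3,0),(0,2),(2,3)]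
    (by decide)

/-- The Paley tournament `P7` on `ℤ/7ℤ`: an arc from `i` to `j` iff `j - i ∈ {1, 2, 4}`. -/
def dirP7 : SimpleDigraph (Fin 7) :=
  ⟨fun i j => j - i = 1 ∨ j - i = 2 ∨ j - i = 4, by decide⟩

/-- The rotative digraph `R(↔K2, ↔K2)`: digons `{0,1}` and `{2,3}`, all arcs from `{0,1}`
to `{2,3}`, all arcs from `{2,3}` to the extra vertex `4`, all arcs from `4` to `{0,1}`. -/
def rotK2K2 : SimpleDigraph (Fin 5) :=
  digraphOfPairs 5 [(0,1),(1,0),(2,3),(3,2),(0,2),(0,3),(1,2),(1,3),(2,4),(3,4),(4,0),(4,1)]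
    (by decide)

/-- The rotative digraph `R(↔K2, C3)`. -/
def rotK2C3 : SimpleDigraph (Fin 6) :=
  digraphOfPairs 6 [(0,1),(1,0),(2,3),(3,4),(4,2),(0,2),(0,3),(0,4),(1,2),(1,3),(1,4),
    (2,5),(3,5),(4,5),(5,0),(5,1)] (by decide)

/-- The rotative digraph `R(C3, ↔K2)`. -/
def rotC3K2 : SimpleDigraph (Fin 6) :=
  digraphOfPairs 6 [(0,1),(1,2),(2,0),(3,4),(4,3),(0,3),(0,4),(1,3),(1,4),(2,3),(2,4),
    (3,5),(4,5),(5,0),(5,1),(5,2)] (by decide)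

/-- The rotative digraph `R(C3, C3)`. -/
def rotC3C3 : SimpleDigraph (Fin 7) :=
  digraphOfPairs 7 [(0,1),(1,2),(2,0),(3,4),(4,5),(5,3),(0,3),(0,4),(0,5),(1,3),(1,4),(1,5),
    (2,3),(2,4),(2,5),(3,6),(4,6),(5,6),(6,0),(6,1),(6,2)] (by decide)

namespace DicriticalSearch

/-! ### A search algorithm

The functions below are evaluated by the kernel and are therefore written with recursors and
with the accelerated operations on natural numbers. -/

noncomputable section

/-- Right fold, by the recursor. -/
def fold {α β : Type} (f : α → β → β) (b : β) (l : List α) : β := List.rec b (fun x _ r => f x r) l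

/-- Fold over the numbers below `n`. -/
def upto {α : Type} (f : ℕ → α → α) (a : α) (n : ℕ) : α := Nat.rec a f n

/-- The value `a` if `c` holds, and `b` otherwise. -/
def sel {α : Type} (c : Bool) (a b : α) : α := Bool.rec b a c

/-- Evaluate `x` before applying `f`. -/
def force {α : Type} (x : ℕ) (f : ℕ → α) : α := Nat.rec (f 0) (fun n _ => f n.succ) x

def every {α : Type} (f : α → Bool) (l : List α) : Bool :=
  fold (fun x b => sel (f x) b false) true l

def anyOf {α : Type} (f : α → Bool) (l : List α) : Bool :=
  fold (fun x b => sel (f x) true b) false l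

def keep {α : Type} (f : α → Bool) (l : List α) : List α :=
  fold (fun x r => sel (f x) (x :: r) r) [] l

def bitAt (x i : ℕ) : Bool := Nat.beq (Nat.land (Nat.shiftRight x i) 1) 1

def setBit (x i : ℕ) : ℕ := Nat.lor x (Nat.shiftLeft 1 i)

def flipBit (x i : ℕ) : ℕ := Nat.xor x (Nat.shiftLeft 1 i)

/-- Sets of numbers are represented by bit masks, and a binary relation on `{0, …, 15}` by the
mask of all `16 * x + y` with `x` related to `y`. This is the product of `s` and `t`, for a subset
`s` of `{0, …, n - 1}`. -/
def outer (n s t : ℕ) : ℕ :=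
  upto (fun x r => sel (bitAt s x) (Nat.lor r (Nat.shiftLeft t (Nat.mul 16 x))) r) 0 n

def arcAt (A x y : ℕ) : Bool := bitAt A (Nat.add (Nat.mul 16 x) y)

/-- The vertices of colour `k` in the colouring of `{0, …, n - 1}` with bit mask `m`. -/
def colourClass (n m : ℕ) (k : Bool) : ℕ := sel k m (Nat.xor (Nat.sub (Nat.shiftLeft 1 n) 1) m)

/-- The relation `A` restricted to the vertices of colour `k`. -/
def classMat (n A m : ℕ) (k : Bool) : ℕ :=
  force (colourClass n m k) fun s => Nat.land A (outer n s s)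

/-- Whether a new vertex can get colour `k` without closing a monochromatic digon or triangle.
Here `Q` is the product of its out-neighbourhood and its in-neighbourhood, and the relation `A`
consists of the arcs and the diagonal. -/
def fits (n A m : ℕ) (k : Bool) (Q : ℕ) : Bool := Nat.beq (Nat.land (classMat n A m k) Q) 0

def removeArc (A u v : ℕ) : ℕ := flipBit A (Nat.add (Nat.mul 16 u) v)

/-- The masks extending those in `l` to a new vertex, such that the new vertex lies on no
monochromatic digon or triangle. -/
def extendMasks (n A : ℕ) (l : List ℕ) (Q : ℕ) : List ℕ :=
  fold (fun m r => sel (fits n A m false Q)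
    (m :: sel (fits n A m true Q) (setBit m n :: r) r)
    (sel (fits n A m true Q) (setBit m n :: r) r)) [] l

/-- Masks in which both the new vertex and `u` can have colour `false`. -/
def newArcMasks (n A : ℕ) (P : List ℕ) (u : ℕ) (Q : ℕ) : List ℕ :=
  keep (fun m => sel (bitAt m u) false (fits n A m false Q)) P

/-- A state of the search: `n` vertices, the relation given by the arcs and the diagonal, a list of
masks containing all proper colourings of these vertices, for some arcs `u → v` a list of possible
masks of the colouring that becomes proper on removal of `u → v`, and a list of all possible pairs
of out- and in-neighbourhoods of a further vertex. -/
structure State where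
  n : ℕ
  mat : ℕ
  proper : List ℕ
  cols : List (ℕ × ℕ × List ℕ)
  cand : List (ℕ × ℕ)

/-- The state without vertices. -/
def State.empty : State := ⟨0, 0, [0], [], [(0, 0)]⟩

/-- Add the masks for the arcs between the new vertex `n` and earlier vertices. -/
def newCols (n A : ℕ) (P : List ℕ) (r : ℕ × ℕ) (l : List (ℕ × ℕ × List ℕ)) :
    List (ℕ × ℕ × List ℕ) :=
  upto (fun u l =>
    (fun l => sel (bitAt r.1 u)
      ((n, u, newArcMasks n A P u (outer n (flipBit r.1 u) r.2)) :: l) l)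
    (sel (bitAt r.2 u) ((u, n, newArcMasks n A P u (outer n r.1 (flipBit r.2 u))) :: l) l)) l n

def extendCand (n : ℕ) (l : List (ℕ × ℕ)) : List (ℕ × ℕ) :=
  fold (fun c l => force (setBit c.1 n) fun o => force (setBit c.2 n) fun i =>
    (o, c.2) :: (c.1, i) :: (o, i) :: l) [] l

/-- Add a vertex with neighbourhoods `r`. -/
def State.extend (st : State) (r : ℕ × ℕ) : State :=
  force (outer st.n r.1 r.2) fun Q =>
    { n := st.n.succ
      mat := Nat.lor st.mat (Nat.lor (outer st.n r.2 (Nat.shiftLeft 1 st.n))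
        (Nat.shiftLeft (setBit r.1 st.n) (Nat.mul 16 st.n)))
      proper := extendMasks st.n st.mat st.proper Q
      cols := newCols st.n st.mat st.proper r (fold (fun e l =>
        (e.1, e.2.1, extendMasks st.n (removeArc st.mat e.1 e.2.1) e.2.2 Q) :: l) [] st.cols)
      cand := extendCand st.n st.cand }

/-- Fix the colouring associated with the arc `u → v`. -/
def State.commit (st : State) (u v m : ℕ) : State :=
  ⟨st.n, st.mat, st.proper, fold (fun e l =>
    sel (Nat.beq e.1 u) (sel (Nat.beq e.2.1 v) ((u, v, [m]) :: l) (e :: l)) (e :: l)) [] st.cols,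
    st.cand⟩

/-- Encodes the adjacency between two vertices `x, y` from the truth values of `x → y` and
`y → x`, at least one of which is true. -/
def digit (p q : Bool) : ℕ := sel p (sel q 2 0) 1

/-- The number with base 3 digits `d`, evaluated along a list. -/
def rowCode {α : Type} (d : α → ℕ) (l : List α) : ℕ :=
  fold (fun i c => Nat.add (d i) (Nat.mul 3 c)) 0 l

/-- Encodes the digraph induced by `A` on a list of vertices. -/
def code {α : Type} (A : α → α → Bool) : List α → ℕ
  | [] => 0
  | x :: L => Nat.add (rowCode (fun i => digit (A x i) (A i x)) L)
      (Nat.mul (Nat.pow 3 L.length) (code A L))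

/-- A tree of tables, indexed by sets of vertices. At each level, the tree branches according to
whether the set contains a vertex. -/
inductive PatTree where
  | leaf
  | node (skip : PatTree) (T : ℕ) (take : PatTree)

/-- A node of a tree, omitted if it has no entries. -/
def PatTree.mkNode (s : PatTree) (T : ℕ) (t : PatTree) : PatTree :=
  PatTree.rec
    (PatTree.rec (sel (Nat.beq T 0) .leaf (.node .leaf T .leaf))
      (fun a T' b _ _ => .node (.node a T' b) T .leaf) s)
    (fun a T' b _ _ => .node s T (.node a T' b)) t

/-- The tree of the tables for all lists that extend `L` by vertices below `j`. The table
for a list contains the codes of those neighbourhoods of a further vertex that complete a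
forbidden digraph on the list. Here `p = 3 ^ L.length`, `c` is the code of `L`, and `tabs` lists
bit masks of the codes of forbidden digraphs, starting with those on `L.length + 2` vertices. -/
def patTree (A : ℕ) : ℕ → List ℕ → ℕ → ℕ → List ℕ → PatTree :=
  Nat.rec (fun _ _ _ _ => .leaf) fun j ih L p c tabs =>
    List.rec .leaf (fun T rest _ =>
      force (Nat.add (rowCode (fun i => digit (arcAt A j i) (arcAt A i j)) L) (Nat.mul p c))
        fun c' => force (Nat.mul 3 p) fun p' =>
          force (Nat.land (Nat.shiftRight T (Nat.mul p' c')) (Nat.sub (Nat.shiftLeft 1 p') 1))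
            fun T' => .mkNode (ih L p c tabs) T' (ih (j :: L) p' c' rest)) tabs

/-- The tree of the tables for all lists that contain the last vertex. -/
def patterns (n A : ℕ) (tabs : List ℕ) : PatTree :=
  Nat.rec .leaf (fun j _ =>
    List.rec .leaf (fun T rest _ => .mkNode .leaf T (patTree A j [j] 3 0 rest)) tabs) n

/-- The digits of the neighbourhoods `r` of a further vertex. -/
def digitsOf (n : ℕ) (r : ℕ × ℕ) : List ℕ :=
  upto (fun x l => force (digit (bitAt r.1 x) (bitAt r.2 x)) fun d => d :: l) [] n

/-- Whether the neighbourhoods of a further vertex, given by their digits, avoid the forbidden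
patterns. -/
def avoids (t : PatTree) : List ℕ → ℕ → Bool :=
  PatTree.rec (fun _ _ => true) (fun _ T _ hs ht ds c =>
    List.rec true (fun d ds _ => force (Nat.add d (Nat.mul 3 c)) fun c' =>
      sel (bitAt T c') false (sel (ht ds c') (hs ds c) false)) ds) t

/-- For each of the arcs `u → v`, the colour classes of all masks. -/
def State.classes (st : State) : List (List ℕ) :=
  fold (fun e l => fold (fun m l =>
    force (classMat st.n (removeArc st.mat e.1 e.2.1) m false) fun M =>
      force (classMat st.n (removeArc st.mat e.1 e.2.1) m true) fun M' =>
        M :: M' :: l) [] e.2.2 :: l) [] st.cols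

/-- Whether a further vertex is compatible with some colouring for each of the arcs. -/
def colourable (classes : List (List ℕ)) (Q : ℕ) : Bool :=
  every (fun l => anyOf (fun M => Nat.beq (Nat.land M Q) 0) l) classes

/-- Discard impossible neighbourhoods of further vertices. -/
def State.refine (tabs : List ℕ) (st : State) : State :=
  ⟨st.n, st.mat, st.proper, st.cols, keep (fun r =>
    sel (avoids (patterns st.n st.mat tabs) (digitsOf st.n r) 0)
      (force (outer st.n r.1 r.2) fun Q => colourable st.classes Q) false) st.cand⟩

/-- The out-neighbours of `x` other than `x`. -/
def outMask (n A x : ℕ) : ℕ :=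
  upto (fun y s => sel (Nat.beq x y) s (sel (arcAt A x y) (setBit s y) s)) 0 n

/-- The in-neighbours of `x` other than `x`. -/
def inMask (n A x : ℕ) : ℕ :=
  upto (fun y s => sel (Nat.beq x y) s (sel (arcAt A y x) (setBit s y) s)) 0 n

/-- Whether the mask `ψ` describes a colouring without monochromatic digons and triangles. -/
def isProper (n A ψ : ℕ) : Bool :=
  upto (fun x b => sel (fits n A ψ (bitAt ψ x) (outer n (outMask n A x) (inMask n A x)))
    b false) true n

/-- Add a vertex with neighbourhoods `r` and colour `k` in the colouring `m` associated with
the arc `u → v`. -/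
def State.push (st : State) (u v m : ℕ) (r : ℕ × ℕ) (k : Bool) : State :=
  (st.extend r).commit u v (sel k (setBit m st.n) m)

/-- Extend `st` by two vertices that form a directed triangle with the vertex `x`. Here `st`
is obtained from a state with `n` vertices by adding the first of these vertices. -/
def State.triangles (st : State) (n u v m : ℕ) (k : Bool) (x : ℕ) (l : List State) : List State :=
  fold (fun q l => sel (bitAt q.1 x) (sel (bitAt q.2 n)
    (sel (fits st.n (removeArc st.mat u v) m k (outer st.n q.1 q.2))
      (st.push u v m q k :: l) l) l) l) l st.cand

/-- The extensions by a vertex with neighbourhoods `r` and colour `k`, or by two such vertices. -/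
def State.child (tabs : List ℕ) (st : State) (u v m ψ : ℕ) (r : ℕ × ℕ) (Q : ℕ) (k : Bool)
    (l : List State) : List State :=
  sel (fits st.n (removeArc st.mat u v) m k Q)
    (sel (fits st.n st.mat ψ k Q)
      (upto (fun x l => sel (bitAt r.2 x) (sel (bitAt (Nat.xor ψ m) x)
        (sel (bitAt (colourClass st.n ψ k) x)
          (((st.push u v m r k).refine tabs).triangles st.n u v (sel k (setBit m st.n) m) k x l)
          l) l) l) l st.n)
      (st.push u v m r k :: l))
    l

/-- The extensions containing a monochromatic cycle of the colouring that is given by `ψ` on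
the vertices of the state, and by the colouring for the arc `u → v` elsewhere. -/
def State.children (tabs : List ℕ) (st : State) (u v m ψ : ℕ) : List State :=
  fold (fun r l => force (outer st.n r.1 r.2) fun Q =>
    st.child tabs u v m ψ r Q false (st.child tabs u v m ψ r Q true l)) [] st.cand

/-- Instructions of the search. -/
inductive Instr where
  /-- The state contains a target digraph, on the given list of vertices. -/
  | found (t : ℕ) (p : List ℕ)
  /-- Branch over the colouring for an arc. -/
  | split (u v : ℕ)
  /-- Recolour the vertices of the state in the colouring for an arc. -/
  | step (u v ψ : ℕ)

/-- Whether the vertices `p` induce the digraph with out-neighbourhoods `T` in `A`. -/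
def matchesAt (n A : ℕ) (T p : List ℕ) : Bool :=
  (List.range T.length).all fun i => Nat.blt (p.getD i 0) n &&
    (List.range T.length).all fun j => Nat.beq i j || (!Nat.beq (p.getD i 0) (p.getD j 0) &&
      (arcAt A (p.getD i 0) (p.getD j 0) == bitAt (T.getD i 0) j))

/-- Run a search on a list of states in succession. -/
def runAll (f : State → List Instr → Option (List Instr)) (sts : List State) :
    List Instr → Option (List Instr) :=
  fold (fun st next l => Option.rec none next (f st l)) some sts

/-- The masks recorded for the arc `u → v`. -/
def State.masks (st : State) (u v : ℕ) : List ℕ :=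
  fold (fun e l => sel (Nat.beq e.1 u) (sel (Nat.beq e.2.1 v) e.2.2 l) l) [] st.cols

/-- Carry out one instruction at a state, handling the resulting states with `next`. -/
def process (targets : List (List ℕ)) (tabs : List ℕ)
    (next : State → List Instr → Option (List Instr)) (st : State) :
    List Instr → Option (List Instr)
  | [] => none
  | .found t p :: l =>
    sel (Nat.blt t targets.length && matchesAt st.n st.mat (targets.getD t []) p) (some l) none
  | .split u v :: l =>
    match st.masks u v with
    | [] => none
    | m :: ms => runAll next (fold (fun m l => st.commit u v m :: l) [] (m :: ms)) l
  | .step u v ψ :: l =>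
    match st.masks u v with
    | [m] => sel (Nat.ble st.n 14 && (Nat.blt ψ (Nat.pow 2 st.n) && isProper st.n st.mat ψ))
        (runAll next (st.children tabs u v m ψ) l) none
    | _ => none

/-- The depth-first search from a state. It consumes a list of instructions. -/
def run (targets : List (List ℕ)) (tabs : List ℕ) (fuel : ℕ) :
    State → List Instr → Option (List Instr) :=
  upto (fun _ next st l =>
    sel (anyOf (fun e => List.isEmpty e.2.2) st.cols) (some l)
      (process targets (tabs.drop 2) next (st.refine (tabs.drop 2)) l)) (fun _ _ => none) fuel

/-- The state given by the first vertices of the digraph with out-neighbourhoods `R`. -/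
def seedState (tabs R : List ℕ) : ℕ → State
  | 0 => .empty
  | i + 1 => ((seedState tabs R i).refine (tabs.drop 2)).extend
      (upto (fun j s => sel (bitAt (R.getD i 0) j) (setBit s j) s) 0 i,
        upto (fun j s => sel (bitAt (R.getD j 0) i) (setBit s j) s) 0 i)

/-- Forbid the digraph with out-neighbourhoods `R`. -/
def forbid (tabs R : List ℕ) : List ℕ :=
  tabs.modify R.length fun T =>
    fold (fun L T => setBit T (code (fun i j => bitAt (R.getD i 0) j) L)) T
      (List.range R.length).permutations'

/-- Whether any two distinct vertices are adjacent. -/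
def isSemiComplete (R : List ℕ) : Bool :=
  (List.range R.length).all fun i => (List.range R.length).all fun j =>
    Nat.beq i j || (bitAt (R.getD i 0) j || bitAt (R.getD j 0) i)

/-- Exclude a sequence of digraphs, each with the help of the preceding ones. -/
def exclude (targets : List (List ℕ)) : List ℕ → List (List ℕ × List Instr) → Bool
  | _, [] => true
  | tabs, (R, l) :: prog =>
    (Nat.ble R.length 16 && isSemiComplete R) &&
      ((run targets tabs 100 (seedState tabs R R.length) l).isSome &&
        exclude targets (forbid tabs R) prog)

/-- The out-neighbourhoods of the eight digraphs of the classification. -/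
def targetRows : List (List ℕ) :=
  [[6, 5, 3],
   [10, 12, 9, 7],
   [22, 13, 24, 17, 3],
   [14, 13, 24, 20, 3],
   [30, 29, 40, 48, 36, 3],
   [26, 28, 25, 48, 40, 7],
   [58, 60, 57, 80, 96, 72, 7],
   [22, 44, 88, 49, 98, 69, 11]]

/-- Small digraphs together with searches that exclude them. -/
def program : List (List ℕ × List Instr) :=
  [([6, 5, 3], [.found 0 [0, 1, 2]]),
   ([8, 9, 3, 7], [.step 2 0 8]),
   ([0, 9, 11, 3], [.split 2 0, .step 2 0 8, .step 2 0 2]),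
   ([8, 9, 11, 3], [.step 2 0 8]),
   ([8, 1, 11, 7], [.step 2 1 8]),
   ([8, 9, 11, 5], [.step 2 1 8]),
   ([0, 9, 11, 7], [.step 1 0 8]),
   ([8, 9, 11, 6], [.step 1 0 8]),
   ([8, 9, 11, 7], [.step 1 0 8]),
   ([12, 9, 2, 7], [.step 3 2 3, .found 2 [3, 0, 2, 4, 1]]),
   ([12, 9, 10, 3], [.step 0 3 12]),
   ([12, 9, 10, 7], [.found 1 [0, 2, 1, 3]]),
   ([4, 9, 3, 7], [
    .step 1 0 12, .split 4 2, .step 4 2 9, .step 4 2 3, .step 3 2 3, .step 2 1 9]),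
   ([4, 13, 1, 7], [.step 1 0 12, .step 3 2 3, .found 3 [1, 3, 0, 2, 4]]),
   ([4, 5, 3], [.step 1 0 4]),
   ([8, 9, 11, 1], [
    .split 2 0, .step 2 0 8, .split 1 0, .step 1 0 8, .split 2 3, .step 2 3 1, .step 2 3 17,
    .step 2 3 3, .step 1 0 12, .split 2 3, .step 2 3 1, .step 2 3 17, .step 2 3 3,
    .step 4 1 33, .split 2 1, .step 2 1 24, .found 5 [1, 5, 2, 0, 3, 4], .step 2 1 17,
    .found 5 [1, 5, 2, 0, 3, 4], .step 1 3 49, .step 1 3 49, .split 2 3, .step 2 3 1,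
    .step 2 3 17, .step 2 3 3]),
   ([0, 1, 11, 7], [
    .split 1 0, .step 1 0 8, .split 2 1, .step 2 1 24, .split 3 0, .step 3 0 20,
    .step 3 0 52, .step 3 0 22, .split 3 0, .step 3 0 20, .step 3 0 22, .split 3 0,
    .step 3 0 20, .step 3 0 22, .step 2 1 9, .split 2 0, .step 2 0 24, .step 2 0 10,
    .split 3 1, .step 3 1 52, .step 3 1 5, .step 3 1 21, .split 3 1, .step 3 1 20,
    .split 3 0, .step 3 0 20, .step 3 0 52, .step 3 0 6, .step 3 0 22, .step 3 1 21,
    .step 2 0 26, .split 3 1, .step 3 1 52, .step 3 1 5, .step 3 1 21, .split 3 1,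
    .step 3 1 5, .step 3 1 21, .found 4 [2, 3, 0, 4, 1, 5], .split 3 1, .step 3 1 20,
    .split 3 0, .step 3 0 20, .step 3 0 52, .step 3 0 6, .step 3 0 22, .step 3 1 21,
    .split 3 1, .step 3 1 20, .step 3 1 5, .step 3 1 21, .step 1 0 4, .split 3 1,
    .step 3 1 20, .split 2 0, .step 2 0 24, .step 2 0 56, .step 2 0 26, .split 2 0,
    .step 2 0 24, .step 2 0 26, .split 2 0, .step 2 0 24, .step 2 0 26, .step 3 1 5,
    .split 2 0, .step 2 0 24, .step 2 0 10, .split 3 1, .step 3 1 52, .step 3 1 5,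
    .step 3 1 21, .split 3 0, .step 3 0 20, .step 3 0 52, .step 3 0 6, .step 3 0 22,
    .step 2 0 26, .split 3 1, .step 3 1 52, .step 3 1 5, .step 3 1 21, .split 3 1,
    .step 3 1 5, .step 3 1 21, .found 4 [2, 3, 0, 4, 1, 5], .split 3 0, .step 3 0 20,
    .step 3 0 52, .step 3 0 6, .step 3 0 22, .split 3 1, .step 3 1 20, .step 3 1 5,
    .step 3 1 21]),
   ([12, 9, 3, 6], [
    .step 1 0 12, .split 4 2, .step 4 2 9, .step 4 2 3, .step 3 2 3, .step 3 1 22,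
    .split 0 3, .step 0 3 6, .step 0 3 22, .split 3 4, .step 3 4 6, .step 3 4 3]),
   ([8, 1, 3, 7], [
    .split 2 1, .step 2 1 8, .split 2 0, .step 2 0 24, .step 2 0 10, .split 4 3,
    .step 4 3 3, .step 4 3 7, .split 4 5, .step 4 5 12, .step 4 5 14, .step 4 5 3,
    .step 4 5 7, .step 2 1 1, .split 3 1, .step 3 1 17, .step 3 1 5, .split 5 4,
    .step 5 4 12, .step 5 4 14, .step 5 4 3, .step 5 4 7, .split 0 4, .step 0 4 12,
    .step 0 4 14]),
   ([8, 9, 3, 5], [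
    .split 2 0, .step 2 0 8, .step 2 0 10, .split 4 2, .step 2 0 26, .step 4 2 3,
    .split 2 1, .step 2 1 24, .step 2 1 24, .split 1 0, .step 1 0 56, .step 1 0 56,
    .step 1 0 56, .step 1 0 56, .step 1 0 56, .split 1 0, .step 1 0 56, .step 1 0 56,
    .step 1 0 56, .step 1 0 56, .split 1 0, .step 1 0 28, .step 1 0 28, .step 1 0 28,
    .split 1 0, .step 1 0 28, .step 1 0 28, .step 1 0 28, .split 1 0, .step 1 0 24,
    .step 1 0 24, .step 1 0 24, .split 0 4, .step 0 4 12, .step 2 0 26]),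
   ([0, 9, 3, 7], [.split 2 0, .step 2 0 8, .step 2 0 2]),
   ([8, 9, 3, 6], [.split 1 0, .step 1 0 8, .step 1 0 12]),
   ([8, 1, 11, 3], [.split 1 0, .step 1 0 8, .step 1 0 14]),
   ([8, 1, 11, 6], [.split 1 0, .step 1 0 8, .step 1 0 8]),
   ([12, 9, 2, 5], [.split 1 0, .step 1 0 12, .step 1 0 12]),
   ([4, 1, 3], [.step 1 0 4]),
   ([4, 5, 1], [.step 1 0 4]),
   ([0, 5, 3], [.step 1 0 4]),
   ([2, 1], [.step 1 0 2]),
   ([0, 17, 3, 23, 5], [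
    .split 3 0, .step 3 0 16, .step 3 0 4, .step 3 0 20, .step 3 0 2, .step 3 0 18,
    .step 3 0 6]),
   ([16, 1, 3, 7, 14], [
    .split 2 1, .step 2 1 16, .step 2 1 24, .split 3 2, .step 3 2 48, .step 3 2 18,
    .step 3 2 33, .step 3 2 49, .split 3 1, .step 3 1 112, .step 3 1 37, .split 5 3,
    .split 4 1, .step 4 1 97, .split 3 1, .step 3 1 112, .step 3 1 97, .step 3 1 113,
    .step 3 1 37, .step 3 1 101, .split 3 1, .step 3 1 112, .step 3 1 97, .step 3 1 113,
    .step 3 1 37, .step 3 1 101, .step 4 1 45, .step 5 3 7, .step 3 2 3, .step 3 2 35,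
    .split 1 0, .step 1 0 56, .step 1 0 28, .step 1 0 60, .split 2 0, .step 2 0 56,
    .step 2 0 82, .split 4 3, .step 4 3 33, .split 3 2, .step 3 2 48, .step 3 2 18,
    .split 2 0, .step 2 0 48, .step 2 0 56, .step 2 0 18, .step 2 0 50, .step 2 0 26,
    .step 3 2 33, .step 3 2 3, .step 3 2 35, .split 4 2, .step 4 2 33, .step 4 2 41,
    .step 4 2 3, .step 4 2 35, .split 3 2, .step 3 2 48, .step 3 2 18, .step 3 2 50,
    .step 3 2 33, .step 3 2 3, .step 3 2 35, .split 4 2, .step 4 2 33, .step 4 2 41,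
    .step 4 2 3, .step 4 2 35, .split 3 2, .step 3 2 48, .step 3 2 18, .step 3 2 50,
    .step 3 2 33, .step 3 2 3, .step 3 2 35, .step 4 3 7, .step 2 1 1, .split 3 5,
    .split 3 2, .split 3 1, .step 3 1 48, .step 3 1 20, .step 3 1 52, .step 3 1 33,
    .step 3 1 49, .step 3 1 5, .step 3 2 50, .split 3 1, .step 3 1 48, .step 3 1 20,
    .step 3 1 52, .step 3 1 33, .step 3 1 49, .step 3 1 5, .split 3 1, .step 3 1 48,
    .step 3 1 20, .step 3 1 52, .step 3 1 33, .step 3 1 49, .step 3 1 5, .step 3 2 3,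
    .step 3 2 35, .split 3 1, .step 3 1 48, .step 3 1 20, .step 3 1 52, .step 3 1 33,
    .step 3 1 49, .step 3 1 5, .step 3 5 5, .step 3 5 3, .step 3 5 7, .step 2 1 17,
    .split 3 1, .step 3 1 48, .step 3 1 20, .split 1 0, .step 1 0 112, .step 1 0 28,
    .split 3 0, .step 3 0 48, .step 3 0 20, .step 3 0 52, .step 3 0 22, .step 3 1 33,
    .step 3 1 49, .split 3 5, .split 3 2, .split 3 1, .step 3 1 48, .step 3 1 20,
    .step 3 1 52, .step 3 1 33, .step 3 1 49, .step 3 1 5, .step 3 2 50, .split 3 1,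
    .step 3 1 48, .step 3 1 20, .step 3 1 52, .step 3 1 33, .step 3 1 49, .step 3 1 5,
    .split 3 1, .step 3 1 48, .step 3 1 20, .step 3 1 52, .step 3 1 33, .step 3 1 49,
    .step 3 1 5, .step 3 2 3, .step 3 2 35, .split 3 1, .step 3 1 48, .step 3 1 20,
    .step 3 1 52, .step 3 1 33, .step 3 1 49, .step 3 1 5, .step 3 5 5, .step 3 5 3,
    .step 3 5 7, .step 2 1 9, .split 3 0, .step 3 0 48, .step 3 0 52, .step 3 0 18,
    .step 3 0 50, .step 3 0 22, .split 4 2, .step 4 2 97, .step 4 2 3, .step 4 2 67,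
    .step 4 2 35, .step 4 2 99, .split 3 2, .step 3 2 112, .step 3 2 82, .step 3 2 114,
    .step 3 2 97, .step 3 2 3, .step 3 2 67, .step 3 2 35, .step 3 2 99, .split 4 2,
    .step 4 2 33, .step 4 2 3, .step 4 2 35, .step 4 2 11, .split 3 5, .split 3 2,
    .split 3 1, .step 3 1 48, .step 3 1 20, .step 3 1 52, .step 3 1 33, .step 3 1 49,
    .step 3 1 5, .step 3 2 50, .split 3 1, .step 3 1 48, .step 3 1 20, .step 3 1 52,
    .step 3 1 33, .step 3 1 49, .step 3 1 5, .split 3 1, .step 3 1 48, .step 3 1 20,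
    .step 3 1 52, .step 3 1 33, .step 3 1 49, .step 3 1 5, .step 3 2 3, .step 3 2 35,
    .split 3 1, .step 3 1 48, .step 3 1 20, .step 3 1 52, .step 3 1 33, .step 3 1 49,
    .step 3 1 5, .step 3 5 5, .step 3 5 3, .step 3 5 7]),
   ([0, 17, 3, 7, 13], [
    .split 3 0, .step 3 0 16, .step 3 0 20, .step 3 0 2, .step 3 0 18, .step 3 0 6,
    .split 2 0, .step 2 0 48, .step 2 0 56, .step 2 0 34, .step 2 0 10, .step 2 0 34,
    .split 1 0, .step 1 0 112, .step 1 0 112, .step 1 0 112, .step 1 0 29, .step 1 0 29,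
    .split 2 0, .step 2 0 48, .step 2 0 56, .step 2 0 34, .step 3 0 48, .step 2 0 34]),
   ([16, 17, 3, 7, 12], [
    .split 2 1, .step 2 1 16, .step 2 1 24, .step 2 1 17, .split 3 1, .step 3 1 16,
    .step 3 1 20, .step 3 1 17, .split 2 0, .step 2 0 16, .split 1 0, .step 1 0 16,
    .step 1 0 24, .step 1 0 20, .step 1 0 12, .step 1 0 28, .step 2 0 18, .step 2 0 3,
    .step 2 0 48, .found 6 [2, 6, 3, 0, 5, 1, 4]]),
   ([0, 1, 19, 7, 11], [
    .split 2 0, .step 2 0 16, .step 2 0 8, .step 2 0 24, .step 2 0 18, .step 2 0 10,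
    .step 2 0 26]),
   ([16, 1, 19, 7, 10], [
    .split 1 0, .step 1 0 16, .step 1 0 16, .step 1 0 16, .step 1 0 16, .step 1 0 16]),
   ([16, 1, 3, 23, 6], [
    .split 1 0, .step 1 0 16, .step 1 0 24, .step 1 0 16, .step 1 0 20, .step 1 0 24,
    .step 1 0 28]),
   ([16, 1, 19, 23, 2], [
    .split 1 0, .step 1 0 16, .step 1 0 16, .step 1 0 24, .step 1 0 24, .step 1 0 20,
    .step 1 0 20, .step 1 0 28, .step 1 0 28]),
   ([8, 17, 3, 6, 13], [
    .split 1 0, .split 2 0, .step 2 0 24, .step 2 0 24, .step 2 0 24, .step 2 0 24,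
    .step 1 0 21, .step 1 0 44, .found 7 [0, 3, 5, 2, 6, 1, 4], .step 1 0 12, .step 1 0 28,
    .step 1 0 56]),
   ([24, 17, 3, 6, 12], [.split 1 0, .step 1 0 24, .step 1 0 24, .step 1 0 24, .step 1 0 24]),
   ([8, 17, 3, 22, 5], [.split 1 0, .step 1 0 24, .step 1 0 24, .step 1 0 24, .step 1 0 24]),
   ([0, 1, 3], [
    .split 2 0, .step 2 0 0, .step 2 0 2, .split 1 0, .step 1 0 8, .step 1 0 8, .step 1 0 8,
    .split 1 0, .step 1 0 8, .step 1 0 8, .step 1 0 8]),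
   ([4, 1, 2], [.split 1 0, .step 1 0 4, .step 1 0 4]),
   ([0, 1], [.step 1 0 0])]

end

/-! ### Basic properties -/

theorem fold_nil {α β : Type} (f : α → β → β) (b : β) : fold f b [] = b := rfl

theorem fold_cons {α β : Type} (f : α → β → β) (b : β) (x : α) (l : List α) :
    fold f b (x :: l) = f x (fold f b l) := rfl

theorem upto_zero {α : Type} (f : ℕ → α → α) (a : α) : upto f a 0 = a := rfl

theorem upto_succ {α : Type} (f : ℕ → α → α) (a : α) (n : ℕ) :
    upto f a (n + 1) = f n (upto f a n) := rfl

@[simp] theorem sel_true {α : Type} (a b : α) : sel true a b = a := rfl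

@[simp] theorem sel_false {α : Type} (a b : α) : sel false a b = b := rfl

@[simp] theorem force_eq {α : Type} (x : ℕ) (f : ℕ → α) : force x f = f x := by
  cases x <;> rfl

theorem fold_induction {α β : Type} {f : α → β → β} {b : β} {l : List α} (P : β → Prop)
    (h0 : P b) (h : ∀ x ∈ l, ∀ r, P r → P (f x r)) : P (fold f b l) := by
  induction l with
  | nil => exact h0
  | cons x l ih =>
    exact h x (by simp) _ (ih fun y hy => h y (by simp [hy]))

theorem fold_of_mem {α β : Type} {f : α → β → β} {b : β} {l : List α} (P : β → Prop) {x : α}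
    (hx : x ∈ l) (h0 : ∀ r, P (f x r)) (h : ∀ y r, P r → P (f y r)) : P (fold f b l) := by
  induction l with
  | nil => simp at hx
  | cons y l ih =>
    rcases List.mem_cons.1 hx with rfl | hx
    · exact h0 _
    · exact h _ _ (ih hx)

theorem upto_induction {α : Type} {f : ℕ → α → α} {a : α} {n : ℕ} (P : α → Prop)
    (h0 : P a) (h : ∀ x < n, ∀ r, P r → P (f x r)) : P (upto f a n) := by
  induction n with
  | zero => exact h0
  | succ n ih => exact h n (by omega) _ (ih fun x hx => h x (by omega))

theorem upto_of_lt {α : Type} {f : ℕ → α → α} {a : α} {n x : ℕ} (P : α → Prop)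
    (hx : x < n) (h0 : ∀ r, P (f x r)) (h : ∀ y r, P r → P (f y r)) : P (upto f a n) := by
  induction n with
  | zero => omega
  | succ n ih =>
    rcases Nat.lt_succ_iff_lt_or_eq.1 hx with hx | rfl
    · exact h _ _ (ih hx)
    · exact h0 _

theorem every_eq {α : Type} (f : α → Bool) (l : List α) : every f l = l.all f := by
  induction l with
  | nil => rfl
  | cons x l ih =>
    rw [every, fold_cons, List.all_cons, ← ih]
    cases f x <;> rfl

theorem anyOf_eq {α : Type} (f : α → Bool) (l : List α) : anyOf f l = l.any f := by
  induction l with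
  | nil => rfl
  | cons x l ih =>
    rw [anyOf, fold_cons, List.any_cons, ← ih]
    cases f x <;> rfl

theorem keep_eq {α : Type} (f : α → Bool) (l : List α) : keep f l = l.filter f := by
  induction l with
  | nil => rfl
  | cons x l ih =>
    rw [keep, fold_cons, List.filter_cons, ← ih]
    cases f x <;> rfl

@[simp] theorem bitAt_eq (x i : ℕ) : bitAt x i = x.testBit i := by
  have h : bitAt x i = Nat.beq ((x >>> i) &&& 1) 1 := rfl
  rw [h, Nat.testBit, Nat.and_comm, Nat.one_and_eq_mod_two]
  rcases Nat.mod_two_eq_zero_or_one (x >>> i) with h | h <;> rw [h] <;> rfl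

theorem testBit_setBit (x i j : ℕ) :
    (setBit x i).testBit j = (x.testBit j || decide (i = j)) := by
  have h : setBit x i = x ||| 1 <<< i := rfl
  rw [h, Nat.testBit_or, Nat.one_shiftLeft, Nat.testBit_two_pow]

theorem testBit_flipBit (x i j : ℕ) :
    (flipBit x i).testBit j = (x.testBit j ^^ decide (i = j)) := by
  have h : flipBit x i = x ^^^ 1 <<< i := rfl
  rw [h, Nat.testBit_xor, Nat.one_shiftLeft, Nat.testBit_two_pow]

/-- The number `x` is the mask of the subset `p` of `{0, …, n - 1}`. -/
def Bits (n x : ℕ) (p : ℕ → Bool) : Prop := ∀ i, x.testBit i = (decide (i < n) && p i)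

/-- The relation `b` on `{0, …, n - 1}` is represented by `A`. -/
def Mat (n A : ℕ) (b : ℕ → ℕ → Bool) : Prop :=
  ∀ i j, j < 16 → A.testBit (16 * i + j) = (decide (i < n) && (decide (j < n) && b i j))

theorem Bits.congr {n x : ℕ} {p q : ℕ → Bool} (h : Bits n x p) (hpq : ∀ i < n, p i = q i) :
    Bits n x q := fun i => by
  rw [h i]
  by_cases hi : i < n
  · rw [hpq i hi]
  · simp [hi]

theorem Mat.congr {n A : ℕ} {b c : ℕ → ℕ → Bool} (h : Mat n A b)
    (hbc : ∀ i < n, ∀ j < n, b i j = c i j) : Mat n A c := fun i j hj => by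
  rw [h i j hj]
  by_cases hi : i < n
  · by_cases hj : j < n
    · rw [hbc i hi j hj]
    · simp [hj]
  · simp [hi]

theorem Bits.apply {n x : ℕ} {p : ℕ → Bool} (h : Bits n x p) {i : ℕ} (hi : i < n) :
    x.testBit i = p i := by simp [h i, hi]

theorem Mat.arcAt {n A : ℕ} {b : ℕ → ℕ → Bool} (h : Mat n A b) (hn : n ≤ 16) {i j : ℕ}
    (hi : i < n) (hj : j < n) : arcAt A i j = b i j := by
  rw [DicriticalSearch.arcAt, bitAt_eq]
  simpa [hi, hj] using h i j (by omega)

theorem Bits.setBit {n x : ℕ} {p : ℕ → Bool} (h : Bits n x p) (hp : p n = true) :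
    Bits (n + 1) (setBit x n) p := fun i => by
  rw [testBit_setBit, h i]
  rcases lt_trichotomy i n with hi | rfl | hi
  · simp [hi, hi.ne', show i < n + 1 by omega]
  · simp [hp]
  · simp [hi.ne, show ¬ i < n + 1 by omega, show ¬ i < n by omega]

theorem Bits.succ {n x : ℕ} {p : ℕ → Bool} (h : Bits n x p) (hp : p n = false) :
    Bits (n + 1) x p := fun i => by
  rw [h i]
  rcases lt_trichotomy i n with hi | rfl | hi
  · simp [hi, show i < n + 1 by omega]
  · simp [hp]
  · simp [show ¬ i < n + 1 by omega, show ¬ i < n by omega]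

theorem Bits.flipBit {n x u : ℕ} {p : ℕ → Bool} (h : Bits n x p) (hu : u < n) (hp : p u = true) :
    Bits n (flipBit x u) fun i => p i && !decide (i = u) := fun i => by
  rw [testBit_flipBit, h i]
  by_cases hi : i = u
  · subst hi; simp [hu, hp]
  · simp [hi, Ne.symm hi]

theorem Bits.colourClass {n m : ℕ} {c : ℕ → Bool} (h : Bits n m c) (k : Bool) :
    Bits n (colourClass n m k) fun i => c i == k := fun i => by
  cases k
  · have e : DicriticalSearch.colourClass n m false = (1 <<< n - 1) ^^^ m := rfl
    rw [e, Nat.testBit_xor, Nat.one_shiftLeft, Nat.testBit_two_pow_sub_one, h i]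
    beta_reduce
    cases decide (i < n) <;> cases c i <;> rfl
  · have e : DicriticalSearch.colourClass n m true = m := rfl
    rw [e, h i]
    simp

theorem upto_setBit {n : ℕ} (p : ℕ → Bool) {f : ℕ → ℕ → ℕ}
    (hf : ∀ i < n, ∀ s, f i s = sel (p i) (setBit s i) s) : Bits n (upto f 0 n) p := by
  induction n with
  | zero => intro i; simp [upto_zero]
  | succ n ih =>
    have h := ih fun i hi => hf i (by omega)
    rw [upto_succ, hf n (by omega)]
    cases hp : p n
    · exact h.succ hp
    · exact h.setBit hp

theorem testBit_outer (n s t : ℕ) (ht : t < 2 ^ 16) (i j : ℕ) (hj : j < 16) :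
    (outer n s t).testBit (16 * i + j) = (decide (i < n) && (s.testBit i && t.testBit j)) := by
  induction n with
  | zero => simp [outer, upto_zero]
  | succ n ih =>
    have key : (t <<< (16 * n)).testBit (16 * i + j) = (decide (i = n) && t.testBit j) := by
      rw [Nat.testBit_shiftLeft]
      rcases lt_trichotomy i n with hi | rfl | hi
      · simp [hi.ne, show ¬ 16 * i + j ≥ 16 * n by omega]
      · simp
      · have : t.testBit (16 * i + j - 16 * n) = false :=
          Nat.testBit_lt_two_pow (ht.trans_le (Nat.pow_le_pow_right (by omega) (by omega)))
        simp [hi.ne', this]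
    have e : outer (n + 1) s t =
        sel (bitAt s n) (outer n s t ||| t <<< (16 * n)) (outer n s t) := rfl
    rw [e, bitAt_eq]
    rcases lt_trichotomy i n with hi | rfl | hi
    · cases s.testBit n <;> simp [ih, key, hi, hi.ne, show i < n + 1 by omega]
    · cases h : s.testBit i <;> simp [ih, key, h]
    · cases s.testBit n <;>
        simp [ih, key, hi.ne', show ¬ i < n by omega, show ¬ i < n + 1 by omega]

theorem Bits.lt {n x : ℕ} {p : ℕ → Bool} (h : Bits n x p) : x < 2 ^ n :=
  Nat.lt_pow_two_of_testBit _ fun i hi => by simp [h i, Nat.not_lt.2 hi]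

theorem Bits.outer {n s t : ℕ} {p q : ℕ → Bool} (hn : n ≤ 16) (hs : Bits n s p) (ht : Bits n t q) :
    Mat n (outer n s t) fun i j => p i && q j := fun i j hj => by
  rw [testBit_outer n s t (ht.lt.trans_le (Nat.pow_le_pow_right (by omega) hn)) i j hj, hs i, ht j]
  cases decide (i < n) <;> cases decide (j < n) <;> simp

theorem Mat.land {n A B : ℕ} {b c : ℕ → ℕ → Bool} (hA : Mat n A b) (hB : Mat n B c) :
    Mat n (Nat.land A B) fun i j => b i j && c i j := fun i j hj => by
  have e : Nat.land A B = A &&& B := rfl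
  rw [e, Nat.testBit_and, hA i j hj, hB i j hj]
  cases decide (i < n) <;> cases decide (j < n) <;> simp

theorem Mat.beq_zero {n A : ℕ} {b : ℕ → ℕ → Bool} (hn : n ≤ 16) (h : Mat n A b) :
    Nat.beq A 0 = true ↔ ∀ i < n, ∀ j < n, b i j = false := by
  rw [Nat.beq_eq]
  constructor
  · rintro rfl i hi j hj
    have := h i j (by omega)
    simpa [hi, hj] using this.symm
  · intro hb
    refine Nat.eq_of_testBit_eq fun k => ?_
    have := h (k / 16) (k % 16) (Nat.mod_lt _ (by omega))
    rw [Nat.div_add_mod] at this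
    rw [this, Nat.zero_testBit]
    by_cases hi : k / 16 < n
    · by_cases hj : k % 16 < n
      · simp [hb _ hi _ hj]
      · simp [hj]
    · simp [hi]

/-- The arcs of `b` and the diagonal. -/
def withDiag (b : ℕ → ℕ → Bool) (i j : ℕ) : Bool := decide (i = j) || b i j

theorem fits_iff {n A m o s : ℕ} {b : ℕ → ℕ → Bool} {c p q : ℕ → Bool} (hn : n ≤ 16)
    (hA : Mat n A (withDiag b)) (hm : Bits n m c) (k : Bool) (ho : Bits n o p) (hs : Bits n s q) :
    fits n A m k (outer n o s) = true ↔
      ∀ i < n, ∀ j < n, c i = k → c j = k → (i = j ∨ b i j = true) → p i = true → q j = true →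
        False := by
  have h := (hA.land ((hm.colourClass k).outer hn (hm.colourClass k))).land (ho.outer hn hs)
  rw [fits, classMat, force_eq, h.beq_zero hn]
  refine forall₂_congr fun i _ => forall₂_congr fun j _ => ?_
  simp only [withDiag]
  by_cases h1 : c i = k <;> by_cases h2 : c j = k <;> by_cases h3 : i = j <;> simp [h1, h2, h3]

theorem Mat.removeArc {n A u v : ℕ} {b : ℕ → ℕ → Bool} (hn : n ≤ 16)
    (h : Mat n A (withDiag b)) (hu : u < n) (hv : v < n) (huv : b u v = true) (hne : u ≠ v) :
    Mat n (removeArc A u v) (withDiag fun i j => b i j && !(decide (i = u) && decide (j = v))) := by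
  intro i j hj
  have e : (16 * u + v = 16 * i + j) ↔ (i = u ∧ j = v) := by omega
  rw [show DicriticalSearch.removeArc A u v = DicriticalSearch.flipBit A (16 * u + v) from rfl,
    testBit_flipBit, h i j hj]
  by_cases h1 : i = u
  · by_cases h2 : j = v
    · subst h1 h2
      simp [withDiag, hu, hv, huv, hne]
    · simp [h1, h2, Ne.symm h2, withDiag]
  · simp [e, h1, withDiag]

theorem fold_map {α β : Type} (g : α → β) (l : List α) :
    fold (fun e r => g e :: r) [] l = l.map g := by
  induction l with
  | nil => rfl
  | cons x l ih => rw [fold_cons, ih, List.map_cons]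

/-! ### Colourings of the vertices of a state -/

/-- The colouring `c` has no monochromatic digon or triangle among the vertices below `n`. -/
def GoodOn (n : ℕ) (b : ℕ → ℕ → Bool) (c : ℕ → Bool) : Prop :=
  ∀ x < n, ∀ y < n, ∀ z < n, b x y = true → (y = z ∨ b y z = true) → b z x = true →
    c x = c y → c y = c z → False

theorem GoodOn.mono {m n : ℕ} {b : ℕ → ℕ → Bool} {c : ℕ → Bool} (h : GoodOn n b c) (hm : m ≤ n) :
    GoodOn m b c := fun x hx y hy z hz =>
  h x (hx.trans_le hm) y (hy.trans_le hm) z (hz.trans_le hm)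

theorem GoodOn.fits {n A m o s : ℕ} {b : ℕ → ℕ → Bool} {c : ℕ → Bool} (h : GoodOn (n + 1) b c)
    (hn : n ≤ 16) (hA : Mat n A (withDiag b)) (hm : Bits n m c) (ho : Bits n o (b n))
    (hs : Bits n s fun i => b i n) : fits n A m (c n) (outer n o s) = true := by
  rw [fits_iff hn hA hm (c n) ho hs]
  intro i hi j hj h1 h2 h3 h4 h5
  exact h n (by omega) i (by omega) j (by omega) h4 h3 h5 h1.symm (h1.trans h2.symm)

theorem exists_mem_extendMasks {n A m o s : ℕ} {b : ℕ → ℕ → Bool} {c : ℕ → Bool} {l : List ℕ}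
    (h : GoodOn (n + 1) b c) (hn : n ≤ 16) (hA : Mat n A (withDiag b)) (hm : Bits n m c)
    (hl : m ∈ l) (ho : Bits n o (b n)) (hs : Bits n s fun i => b i n) :
    ∃ m' ∈ extendMasks n A l (outer n o s), Bits (n + 1) m' c := by
  have hf := h.fits hn hA hm ho hs
  refine fold_of_mem (fun r => ∃ m' ∈ r, Bits (n + 1) m' c) hl (fun r => ?_) fun y r => ?_
  · cases hc : c n <;> rw [hc] at hf <;> simp only [hf, sel_true]
    · exact ⟨m, by simp, hm.succ hc⟩
    · cases fits n A m false (outer n o s)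
      · exact ⟨setBit m n, by simp, hm.setBit hc⟩
      · exact ⟨setBit m n, by simp, hm.setBit hc⟩
  · rintro ⟨m', hm', hb⟩
    refine ⟨m', ?_, hb⟩
    cases fits n A y false (outer n o s) <;> cases fits n A y true (outer n o s) <;> simp [hm']

theorem exists_mem_newArcMasks {n A m u o s : ℕ} {b : ℕ → ℕ → Bool} {c : ℕ → Bool} {l : List ℕ}
    (h : GoodOn (n + 1) b c) (hn : n ≤ 16) (hA : Mat n A (withDiag b)) (hm : Bits n m c)
    (hl : m ∈ l) (ho : Bits n o (b n)) (hs : Bits n s fun i => b i n) (hu : u < n)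
    (hcu : c u = false) (hcn : c n = false) :
    ∃ m' ∈ newArcMasks n A l u (outer n o s), Bits (n + 1) m' c := by
  refine ⟨m, ?_, hm.succ hcn⟩
  have hf := h.fits hn hA hm ho hs
  rw [hcn] at hf
  rw [newArcMasks, keep_eq, List.mem_filter]
  exact ⟨hl, by simp [hm.apply hu, hcu, hf]⟩

theorem mem_newCols {n A : ℕ} {P : List ℕ} {r : ℕ × ℕ} {l : List (ℕ × ℕ × List ℕ)}
    {e : ℕ × ℕ × List ℕ} (he : e ∈ newCols n A P r l) : e ∈ l ∨ ∃ u < n,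
      (r.1.testBit u = true ∧ e = (n, u, newArcMasks n A P u (outer n (flipBit r.1 u) r.2))) ∨
      (r.2.testBit u = true ∧ e = (u, n, newArcMasks n A P u (outer n r.1 (flipBit r.2 u)))) := by
  revert he
  refine upto_induction (fun l' => e ∈ l' → e ∈ l ∨ ∃ u < n,
      (r.1.testBit u = true ∧ e = (n, u, newArcMasks n A P u (outer n (flipBit r.1 u) r.2))) ∨
      (r.2.testBit u = true ∧ e = (u, n, newArcMasks n A P u (outer n r.1 (flipBit r.2 u)))))
    Or.inl fun u hu l' ih => ?_
  simp only [bitAt_eq]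
  cases h1 : r.1.testBit u <;> cases h2 : r.2.testBit u <;>
    simp only [sel_true, sel_false, List.mem_cons]
  · exact ih
  · rintro (h | h)
    · exact .inr ⟨u, hu, .inr ⟨h2, h⟩⟩
    · exact ih h
  · rintro (h | h)
    · exact .inr ⟨u, hu, .inl ⟨h1, h⟩⟩
    · exact ih h
  · rintro (h | h | h)
    · exact .inr ⟨u, hu, .inl ⟨h1, h⟩⟩
    · exact .inr ⟨u, hu, .inr ⟨h2, h⟩⟩
    · exact ih h

theorem Mat.extend {n A : ℕ} {r : ℕ × ℕ} {b : ℕ → ℕ → Bool} (hn : n < 16)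
    (hA : Mat n A (withDiag b)) (ho : Bits n r.1 (b n)) (hs : Bits n r.2 fun i => b i n) :
    Mat (n + 1) (Nat.lor A (Nat.lor (outer n r.2 (Nat.shiftLeft 1 n))
        (Nat.shiftLeft (setBit r.1 n) (Nat.mul 16 n)))) (withDiag b) := by
  intro i j hj
  have e : Nat.lor A (Nat.lor (outer n r.2 (Nat.shiftLeft 1 n))
        (Nat.shiftLeft (setBit r.1 n) (Nat.mul 16 n))) =
      A ||| (outer n r.2 (2 ^ n) ||| setBit r.1 n <<< (16 * n)) := by
    rw [← Nat.one_shiftLeft]; rfl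
  rw [e, Nat.testBit_or, Nat.testBit_or, hA i j hj,
    testBit_outer n r.2 _ (Nat.pow_lt_pow_right (by omega) hn) i j hj, Nat.testBit_shiftLeft,
    testBit_setBit, hs i, Nat.testBit_two_pow, withDiag]
  rcases lt_trichotomy i n with hi | rfl | hi
  · rcases lt_trichotomy j n with hj' | rfl | hj'
    · simp [hi, hj', show ¬ 16 * n ≤ 16 * i + j by omega, show i < n + 1 by omega,
        show j < n + 1 by omega, hj'.ne']
    · simp [hi, hi.ne, show ¬ 16 * j ≤ 16 * i + j by omega, show i < j + 1 by omega]
    · simp [hi, show ¬ 16 * n ≤ 16 * i + j by omega, show i < n + 1 by omega,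
        show ¬ j < n + 1 by omega, show ¬ j < n by omega, hj'.ne]
  · rw [show 16 * i + j - 16 * i = j by omega, ho j]
    rcases lt_trichotomy j i with hj' | rfl | hj'
    · simp [hj', hj'.ne', show j < i + 1 by omega]
    · simp
    · simp [hj'.ne, show ¬ j < i + 1 by omega, show ¬ j < i by omega]
  · have h1 := ho (16 * i + j - 16 * n)
    rw [h1]
    simp [show ¬ i < n + 1 by omega, show ¬ i < n by omega,
      show ¬ 16 * i + j - 16 * n < n by omega, show ¬ n = 16 * i + j - 16 * n by omega]

/-! ### Realizations of states -/

/-- The colouring `c` has no monochromatic digon or triangle. -/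
def Good {V : Type} (b : V → V → Bool) (c : V → Bool) : Prop :=
  ∀ x y z, b x y = true → (y = z ∨ b y z = true) → b z x = true → c x = c y → c y = c z → False

theorem Good.goodOn {V : Type} {b : V → V → Bool} {c : V → Bool} (h : Good b c) (n : ℕ)
    (f : ℕ → V) : GoodOn n (fun i j => b (f i) (f j)) fun i => c (f i) :=
  fun x _ y _ z _ h1 h2 h3 h4 h5 => h (f x) (f y) (f z) h1 (h2.imp (congrArg f) id) h3 h4 h5

open scoped Classical in
/-- Remove the arc `p → q`. -/
noncomputable def del {V : Type} (a : V → V → Bool) (p q x y : V) : Bool :=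
  a x y && !(decide (x = p) && decide (y = q))

/-- The relation `a` is semi-complete and has no colouring without monochromatic digons and
triangles, while the colouring `φ p q` is such a colouring after removal of the arc `p → q`. -/
structure Critical {V : Type} (a : V → V → Bool) (φ : V → V → V → Bool) :
    Prop where
  irrefl : ∀ x, a x x = false
  total : ∀ x y, x ≠ y → a x y = true ∨ a y x = true
  not_good : ∀ c, ¬ Good a c
  good : ∀ p q, a p q = true → Good (del a p q) (φ p q)
  left : ∀ p q, a p q = true → φ p q p = false
  right : ∀ p q, a p q = true → φ p q q = false

section

variable {V : Type} {a : V → V → Bool} {φ : V → V → V → Bool}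

/-- The vertices `f 0, …, f (st.n - 1)` are described correctly by the state. -/
structure Realizes (a : V → V → Bool) (φ : V → V → V → Bool) (st : State) (f : ℕ → V) :
    Prop where
  le : st.n ≤ 16
  inj : ∀ i < st.n, ∀ j < st.n, f i = f j → i = j
  mat : Mat st.n st.mat (withDiag fun i j => a (f i) (f j))
  proper : ∀ c, GoodOn st.n (fun i j => a (f i) (f j)) c → ∃ m ∈ st.proper, Bits st.n m c
  cols : ∀ e ∈ st.cols, e.1 < st.n ∧
    e.2.1 < st.n ∧ a (f e.1) (f e.2.1) = true ∧
    ∃ m ∈ e.2.2, Bits st.n m fun i => φ (f e.1) (f e.2.1) (f i)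
  cand : ∀ x, (∀ i < st.n, f i ≠ x) →
    ∃ r ∈ st.cand, Bits st.n r.1 (fun i => a x (f i)) ∧ Bits st.n r.2 fun i => a (f i) x

theorem realizes_empty (f : ℕ → V) : Realizes a φ State.empty f where
  le := by simp [State.empty]
  inj i hi := absurd hi (Nat.not_lt_zero i)
  mat i j _ := by simp [State.empty]
  proper c _ := ⟨0, by simp [State.empty], fun i => by simp [State.empty]⟩
  cols e he := by simp [State.empty] at he
  cand x _ := ⟨(0, 0), by simp [State.empty], fun i => by simp [State.empty],
    fun i => by simp [State.empty]⟩

theorem Realizes.congr {st : State} {f g : ℕ → V} (h : Realizes a φ st f)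
    (hfg : ∀ i < st.n, f i = g i) : Realizes a φ st g where
  le := h.le
  inj i hi j hj := by
    rw [← hfg i hi, ← hfg j hj]
    exact h.inj i hi j hj
  mat := h.mat.congr fun i hi j hj => by rw [withDiag, withDiag, hfg i hi, hfg j hj]
  proper c hc := by
    refine h.proper c fun x hx y hy z hz => ?_
    beta_reduce
    rw [hfg x hx, hfg y hy, hfg z hz]
    exact hc x hx y hy z hz
  cols e he := by
    obtain ⟨h1, h2, h3, m, hm, h4⟩ := h.cols e he
    rw [← hfg _ h1, ← hfg _ h2]
    exact ⟨h1, h2, h3, m, hm, h4.congr fun i hi => by rw [hfg i hi]⟩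
  cand x hx := by
    obtain ⟨r, hr, h1, h2⟩ := h.cand x fun i hi => by
      rw [hfg i hi]
      exact hx i hi
    exact ⟨r, hr, h1.congr fun i hi => by rw [hfg i hi], h2.congr fun i hi => by rw [hfg i hi]⟩

theorem Realizes.mat_del {st : State} {f : ℕ → V} (h : Realizes a φ st f) (ha : ∀ x, a x x = false)
    {u v : ℕ} (hu : u < st.n) (hv : v < st.n) (huv : a (f u) (f v) = true) :
    Mat st.n (removeArc st.mat u v) (withDiag fun i j => del a (f u) (f v) (f i) (f j)) := by
  have hne : u ≠ v := by
    rintro rfl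
    simp [ha] at huv
  refine (h.mat.removeArc h.le hu hv huv hne).congr fun i hi j hj => ?_
  have h1 : f i = f u ↔ i = u := ⟨h.inj i hi u hu, congrArg f⟩
  have h2 : f j = f v ↔ j = v := ⟨h.inj j hj v hv, congrArg f⟩
  simp only [withDiag, del, h1, h2]

theorem Realizes.extend (hc : Critical a φ) {st : State} {f : ℕ → V} (h : Realizes a φ st f)
    (hn : st.n < 16) (hf : ∀ i < st.n, f i ≠ f st.n) {r : ℕ × ℕ}
    (ho : Bits st.n r.1 fun i => a (f st.n) (f i)) (hs : Bits st.n r.2 fun i => a (f i) (f st.n)) :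
    Realizes a φ (st.extend r) f := by
  rw [State.extend, force_eq]
  refine ⟨hn, fun i hi j hj hij => ?_, h.mat.extend hn ho hs, fun c hg => ?_, fun e he => ?_,
    fun x hx => ?_⟩
  · rcases Nat.lt_succ_iff_lt_or_eq.1 hi with hi | rfl <;>
      rcases Nat.lt_succ_iff_lt_or_eq.1 hj with hj | rfl
    · exact h.inj i hi j hj hij
    · exact absurd hij (hf i hi)
    · exact absurd hij.symm (hf j hj)
    · rfl
  · obtain ⟨m, hm, hb⟩ := h.proper c (hg.mono (Nat.le_succ _))
    exact exists_mem_extendMasks hg h.le h.mat hb hm ho hs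
  · rcases mem_newCols he with he | ⟨u, hu, ⟨hr, rfl⟩ | ⟨hr, rfl⟩⟩
    · rw [fold_map, List.mem_map] at he
      obtain ⟨e, hmem, rfl⟩ := he
      obtain ⟨h1, h2, h3, m, hm, h4⟩ := h.cols e hmem
      refine ⟨h1.trans (Nat.lt_succ_self _), h2.trans (Nat.lt_succ_self _), h3, ?_⟩
      refine exists_mem_extendMasks (b := fun i j => del a (f e.1) (f e.2.1) (f i) (f j))
        ((hc.good _ _ h3).goodOn _ f) h.le (h.mat_del hc.irrefl h1 h2 h3) h4 hm
        (ho.congr fun i hi => ?_) (hs.congr fun i hi => ?_)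
      · simp [del, (hf _ h1).symm]
      · simp [del, (hf _ h2).symm]
    · have hr' : a (f st.n) (f u) = true := by rw [← hr, ho.apply hu]
      have hg := (hc.good _ _ hr').goodOn (st.n + 1) f
      have hb : ∀ i < st.n, ∀ j < st.n, del a (f st.n) (f u) (f i) (f j) = a (f i) (f j) :=
        fun i hi j hj => by simp [del, hf i hi]
      have hg' : GoodOn st.n (fun i j => a (f i) (f j)) fun i => φ (f st.n) (f u) (f i) := by
        refine fun x hx y hy z hz => ?_
        have := hg x (by omega) y (by omega) z (by omega)
        simp only [hb x hx y hy, hb y hy z hz, hb z hz x hx] at this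
        exact this
      obtain ⟨m, hm, hbits⟩ := h.proper _ hg'
      refine ⟨Nat.lt_succ_self _, hu.trans (Nat.lt_succ_self _), hr', ?_⟩
      refine exists_mem_newArcMasks hg h.le
        (h.mat.congr fun i hi j hj => by simp only [withDiag, hb i hi j hj]) hbits hm
        ((ho.flipBit hu hr').congr fun i hi => ?_) (hs.congr fun i hi => ?_) hu
        (hc.right _ _ hr') (hc.left _ _ hr')
      · have : f i = f u ↔ i = u := ⟨h.inj i hi u hu, congrArg f⟩
        simp [del, this]
      · simp [del, hf i hi]
    · have hr' : a (f u) (f st.n) = true := by rw [← hr, hs.apply hu]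
      have hg := (hc.good _ _ hr').goodOn (st.n + 1) f
      have hb : ∀ i < st.n, ∀ j < st.n, del a (f u) (f st.n) (f i) (f j) = a (f i) (f j) :=
        fun i hi j hj => by simp [del, hf j hj]
      have hg' : GoodOn st.n (fun i j => a (f i) (f j)) fun i => φ (f u) (f st.n) (f i) := by
        refine fun x hx y hy z hz => ?_
        have := hg x (by omega) y (by omega) z (by omega)
        simp only [hb x hx y hy, hb y hy z hz, hb z hz x hx] at this
        exact this
      obtain ⟨m, hm, hbits⟩ := h.proper _ hg'
      refine ⟨hu.trans (Nat.lt_succ_self _), Nat.lt_succ_self _, hr', ?_⟩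
      refine exists_mem_newArcMasks hg h.le
        (h.mat.congr fun i hi j hj => by simp only [withDiag, hb i hi j hj]) hbits hm
        (ho.congr fun i hi => ?_) ((hs.flipBit hu hr').congr fun i hi => ?_) hu
        (hc.left _ _ hr') (hc.right _ _ hr')
      · simp [del, hf i hi]
      · have : f i = f u ↔ i = u := ⟨h.inj i hi u hu, congrArg f⟩
        simp [del, this]
  · obtain ⟨r', hr', h1, h2⟩ := h.cand x fun i hi => hx i (hi.trans (Nat.lt_succ_self _))
    have hx' := hx st.n (Nat.lt_succ_self _)
    refine fold_of_mem (fun l : List (ℕ × ℕ) => ∃ r ∈ l, Bits (st.n + 1) r.1 (fun i => a x (f i)) ∧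
      Bits (st.n + 1) r.2 fun i => a (f i) x) hr' (fun l => ?_) fun y l => ?_
    · simp only [force_eq]
      cases h3 : a x (f st.n) <;> cases h4 : a (f st.n) x
      · have := hc.total _ _ hx'
        simp [h3, h4] at this
      · exact ⟨(r'.1, setBit r'.2 st.n), by simp, h1.succ h3, h2.setBit h4⟩
      · exact ⟨(setBit r'.1 st.n, r'.2), by simp, h1.setBit h3, h2.succ h4⟩
      · exact ⟨(setBit r'.1 st.n, setBit r'.2 st.n), by simp, h1.setBit h3, h2.setBit h4⟩
    · rintro ⟨r, hr, hb⟩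
      exact ⟨r, by simp [hr], hb⟩

theorem Realizes.commit {st : State} {f : ℕ → V} (h : Realizes a φ st f) {u v m : ℕ}
    (hm : u < st.n → v < st.n → Bits st.n m fun i => φ (f u) (f v) (f i)) :
    Realizes a φ (st.commit u v m) f := by
  refine ⟨h.le, h.inj, h.mat, h.proper, ?_, h.cand⟩
  refine fold_induction (fun l : List (ℕ × ℕ × List ℕ) => ∀ e ∈ l, e.1 < st.n ∧
    e.2.1 < st.n ∧ a (f e.1) (f e.2.1) = true ∧
    ∃ m ∈ e.2.2, Bits st.n m fun i => φ (f e.1) (f e.2.1) (f i)) (by simp) fun e he l ih => ?_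
  have he' := h.cols e he
  have h0 : ∀ e' ∈ e :: l, e'.1 < st.n ∧ e'.2.1 < st.n ∧ a (f e'.1) (f e'.2.1) = true ∧
      ∃ m ∈ e'.2.2, Bits st.n m fun i => φ (f e'.1) (f e'.2.1) (f i) := by
    simp only [List.mem_cons, forall_eq_or_imp]
    exact ⟨he', ih⟩
  cases h1 : Nat.beq e.1 u
  · exact h0
  · cases h2 : Nat.beq e.2.1 v
    · exact h0
    · simp only [sel_true, List.mem_cons, forall_eq_or_imp]
      rw [Nat.beq_eq] at h1 h2
      rw [h1, h2] at he'
      exact ⟨⟨he'.1, he'.2.1, he'.2.2.1, m, by simp, hm he'.1 he'.2.1⟩, ih⟩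

theorem Realizes.exists_mem_masks {st : State} {f : ℕ → V} (h : Realizes a φ st f) {u v : ℕ}
    (hne : st.masks u v ≠ []) : u < st.n ∧ v < st.n ∧ a (f u) (f v) = true ∧
      ∃ m ∈ st.masks u v, Bits st.n m fun i => φ (f u) (f v) (f i) := by
  revert hne
  refine fold_induction (fun l => l ≠ [] → u < st.n ∧ v < st.n ∧ a (f u) (f v) = true ∧
      ∃ m ∈ l, Bits st.n m fun i => φ (f u) (f v) (f i)) (by simp) fun e he l ih => ?_
  have he' := h.cols e he
  cases h1 : Nat.beq e.1 u
  · exact ih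
  · cases h2 : Nat.beq e.2.1 v
    · exact ih
    · rw [Nat.beq_eq] at h1 h2
      rw [h1, h2] at he'
      exact fun _ => he'

end

/-! ### Forbidden digraphs -/

/-- No list of vertices induces a digraph whose code is recorded in `tabs`. -/
def Clean {V : Type} (a : V → V → Bool) (tabs : List ℕ) : Prop :=
  ∀ M : List V, M.Nodup → (tabs.getD M.length 0).testBit (code a M) = false

theorem rowCode_cons {α : Type} (d : α → ℕ) (x : α) (l : List α) :
    rowCode d (x :: l) = d x + 3 * rowCode d l := rfl

theorem code_cons {α : Type} (A : α → α → Bool) (x : α) (l : List α) :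
    code A (x :: l) = rowCode (fun i => digit (A x i) (A i x)) l + 3 ^ l.length * code A l := rfl

theorem rowCode_map {α β : Type} (d : β → ℕ) (f : α → β) (l : List α) :
    rowCode d (l.map f) = rowCode (fun i => d (f i)) l := by
  induction l with
  | nil => rfl
  | cons x l ih => rw [List.map_cons, rowCode_cons, rowCode_cons, ih]

theorem rowCode_congr {α : Type} {d e : α → ℕ} {l : List α} (h : ∀ x ∈ l, d x = e x) :
    rowCode d l = rowCode e l := by
  induction l with
  | nil => rfl
  | cons x l ih =>
    rw [rowCode_cons, rowCode_cons, h x (by simp), ih fun y hy => h y (by simp [hy])]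

theorem code_map {α β : Type} (A : β → β → Bool) (f : α → β) (l : List α) :
    code A (l.map f) = code (fun i j => A (f i) (f j)) l := by
  induction l with
  | nil => rfl
  | cons x l ih => rw [List.map_cons, code_cons, code_cons, rowCode_map, ih, List.length_map]

theorem digit_lt (p q : Bool) : digit p q < 3 := by cases p <;> cases q <;> decide

theorem rowCode_lt {α : Type} {d : α → ℕ} {l : List α} (h : ∀ x ∈ l, d x < 3) :
    rowCode d l < 3 ^ l.length := by
  induction l with
  | nil => simp [rowCode, fold_nil]
  | cons x l ih =>
    have h1 := ih fun y hy => h y (by simp [hy])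
    have h2 := h x (by simp)
    rw [rowCode_cons, List.length_cons, pow_succ]
    omega

theorem avoids_leaf (ds : List ℕ) (c : ℕ) : avoids .leaf ds c = true := rfl

theorem avoids_node_cons (s t : PatTree) (T c d : ℕ) (ds : List ℕ) :
    avoids (.node s T t) (d :: ds) c =
      (!T.testBit (d + 3 * c) && (avoids t ds (d + 3 * c) && avoids s ds c)) := by
  have e : avoids (.node s T t) (d :: ds) c = force (Nat.add d (Nat.mul 3 c)) fun c' =>
      sel (bitAt T c') false (sel (avoids t ds c') (avoids s ds c) false) := rfl
  have e' : Nat.add d (Nat.mul 3 c) = d + 3 * c := rfl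
  rw [e, force_eq, e', bitAt_eq]
  cases T.testBit (d + 3 * c) <;> cases avoids t ds (d + 3 * c) <;> simp

theorem avoids_mkNode (s t : PatTree) (T : ℕ) (ds : List ℕ) (c : ℕ) :
    avoids (.mkNode s T t) ds c = avoids (.node s T t) ds c := by
  cases t with
  | node => rfl
  | leaf =>
    cases s with
    | node => rfl
    | leaf =>
      have e : PatTree.mkNode .leaf T .leaf = sel (Nat.beq T 0) .leaf (.node .leaf T .leaf) := rfl
      rw [e]
      cases h : Nat.beq T 0
      · rfl
      · rw [Nat.beq_eq] at h
        subst h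
        cases ds
        · rfl
        · rw [avoids_node_cons]
          simp [avoids_leaf]

theorem digitsOf_succ (n : ℕ) (r : ℕ × ℕ) :
    digitsOf (n + 1) r = digit (r.1.testBit n) (r.2.testBit n) :: digitsOf n r := by
  rw [digitsOf, upto_succ, force_eq, bitAt_eq, bitAt_eq]
  rfl

theorem patTree_succ_nil (A j : ℕ) (L : List ℕ) (p c : ℕ) :
    patTree A (j + 1) L p c [] = .leaf := rfl

theorem patTree_succ_cons (A j : ℕ) (L : List ℕ) (p c T : ℕ) (rest : List ℕ) :
    patTree A (j + 1) L p c (T :: rest) =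
      (fun c' => .mkNode (patTree A j L p c (T :: rest))
        ((T >>> (3 * p * c')) &&& (2 ^ (3 * p) - 1)) (patTree A j (j :: L) (3 * p) c' rest))
      (rowCode (fun i => digit (arcAt A j i) (arcAt A i j)) L + p * c) := by
  rw [← Nat.one_shiftLeft]
  have e : patTree A (j + 1) L p c (T :: rest) = force
      (Nat.add (rowCode (fun i => digit (arcAt A j i) (arcAt A i j)) L) (Nat.mul p c))
        fun c' => force (Nat.mul 3 p) fun p' =>
          force (Nat.land (Nat.shiftRight T (Nat.mul p' c')) (Nat.sub (Nat.shiftLeft 1 p') 1))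
            fun T' => .mkNode (patTree A j L p c (T :: rest)) T'
              (patTree A j (j :: L) p' c' rest) := rfl
  rw [e, force_eq, force_eq, force_eq]
  rfl

theorem avoids_patTree {n A : ℕ} {b : ℕ → ℕ → Bool} {tabs : List ℕ} {r : ℕ × ℕ} (hn : n ≤ 16)
    (hA : Mat n A (withDiag b)) (ho : Bits n r.1 (b n)) (hs : Bits n r.2 fun i => b i n)
    (hclean : ∀ M : List ℕ, (∀ i ∈ M, i < n + 1) → M.Nodup →
      (tabs.getD M.length 0).testBit (code b M) = false) (j : ℕ) (hj : j ≤ n) :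
    ∀ L : List ℕ, (∀ i ∈ L, j ≤ i ∧ i < n) → L.Nodup →
      avoids (patTree A j L (3 ^ L.length) (code b L) (tabs.drop (L.length + 2))) (digitsOf j r)
        (rowCode (fun i => digit (b n i) (b i n)) L) = true := by
  induction j with
  | zero => intros; rfl
  | succ j ih =>
    intro L hL hnd
    cases htabs : tabs.drop (L.length + 2) with
    | nil => rw [patTree_succ_nil, avoids_leaf]
    | cons T rest =>
      have hL' : ∀ i ∈ j :: L, j ≤ i ∧ i < n := by
        intro i hi
        rcases List.mem_cons.1 hi with rfl | hi
        · omega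
        · have := hL i hi
          omega
      have hnd' : (j :: L).Nodup := List.nodup_cons.2 ⟨fun h => by have := hL j h; omega, hnd⟩
      have hc : rowCode (fun i => digit (arcAt A j i) (arcAt A i j)) L + 3 ^ L.length * code b L =
          code b (j :: L) := by
        rw [code_cons]
        congr 1
        refine rowCode_congr fun i hi => ?_
        have hi' := hL i hi
        rw [hA.arcAt hn (by omega) hi'.2, hA.arcAt hn hi'.2 (by omega), withDiag, withDiag]
        simp [show j ≠ i by omega, show i ≠ j by omega]
      rw [patTree_succ_cons, hc, avoids_mkNode, digitsOf_succ, avoids_node_cons,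
        ho.apply (show j < n by omega), hs.apply (show j < n by omega)]
      have hr : digit (b n j) (b j n) + 3 * rowCode (fun i => digit (b n i) (b i n)) L =
          rowCode (fun i => digit (b n i) (b i n)) (j :: L) := rfl
      have hp : 3 * 3 ^ L.length = 3 ^ (j :: L).length := by rw [List.length_cons, pow_succ']
      rw [hr, hp]
      have hdrop : tabs.drop ((j :: L).length + 2) = rest := by
        have : tabs.drop ((j :: L).length + 2) = (tabs.drop (L.length + 2)).drop 1 := by
          rw [List.drop_drop]; rfl
        rw [this, htabs]
        rfl
      have h1 := ih (by omega) L (fun i hi => hL' i (by simp [hi])) hnd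
      have h2 := ih (by omega) (j :: L) hL' hnd'
      rw [htabs] at h1
      rw [hdrop] at h2
      rw [h1, h2]
      have hT : tabs.getD (L.length + 2) 0 = T := by
        have := congrArg (fun l => l.getD 0 0) htabs
        simpa [List.getD_eq_getElem?_getD] using this
      have h3 := hclean (n :: j :: L) (by
        intro i hi
        rcases List.mem_cons.1 hi with rfl | hi
        · omega
        · have := hL' i hi
          omega) (List.nodup_cons.2 ⟨fun h => by have := hL' n h; omega, hnd'⟩)
      rw [code_cons, show (n :: j :: L).length = L.length + 2 from rfl, hT] at h3
      rw [Nat.testBit_and, Nat.testBit_shiftRight, add_comm, h3]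
      rfl

theorem avoids_patterns {n A : ℕ} {b : ℕ → ℕ → Bool} {tabs : List ℕ} {r : ℕ × ℕ} (hn : n ≤ 16)
    (hA : Mat n A (withDiag b)) (ho : Bits n r.1 (b n)) (hs : Bits n r.2 fun i => b i n)
    (hclean : ∀ M : List ℕ, (∀ i ∈ M, i < n + 1) → M.Nodup →
      (tabs.getD M.length 0).testBit (code b M) = false) :
    avoids (patterns n A (tabs.drop 2)) (digitsOf n r) 0 = true := by
  cases n with
  | zero => rfl
  | succ j =>
    cases htabs : tabs.drop 2 with
    | nil => rfl
    | cons T rest =>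
      have e : patterns (j + 1) A (T :: rest) = .mkNode .leaf T (patTree A j [j] 3 0 rest) := rfl
      have h := avoids_patTree hn hA ho hs hclean j (by omega) [j] (by simp) (by simp)
      have hdrop : tabs.drop ([j].length + 2) = rest := by
        have : tabs.drop ([j].length + 2) = (tabs.drop 2).drop 1 := by
          rw [List.drop_drop]; rfl
        rw [this, htabs]
        rfl
      have hT : tabs.getD 2 0 = T := by
        have := congrArg (fun l => l.getD 0 0) htabs
        simpa [List.getD_eq_getElem?_getD] using this
      have h3 := hclean [j + 1, j] (by simp) (by simp)
      rw [show [j + 1, j].length = 2 from rfl, hT] at h3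
      rw [hdrop] at h
      rw [e, avoids_mkNode, digitsOf_succ, avoids_node_cons, ho.apply (show j < j + 1 by omega),
        hs.apply (show j < j + 1 by omega), avoids_leaf, Bool.and_true]
      have h' : avoids (patTree A j [j] 3 0 rest) (digitsOf j r)
        (digit (b (j + 1) j) (b j (j + 1)) + 3 * 0) = true := h
      have h3' : T.testBit (digit (b (j + 1) j) (b j (j + 1)) + 3 * 0) = false := h3
      rw [h', h3']
      rfl

/-! ### Neighbourhoods of further vertices -/

section

variable {V : Type} {a : V → V → Bool} {φ : V → V → V → Bool}

theorem exists_mem_classes {st : State} {l : List ℕ} (hl : l ∈ st.classes) : ∃ e ∈ st.cols,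
    ∀ m ∈ e.2.2, ∀ k, classMat st.n (removeArc st.mat e.1 e.2.1) m k ∈ l := by
  rw [State.classes, fold_map, List.mem_map] at hl
  obtain ⟨e, he, rfl⟩ := hl
  refine ⟨e, he, fun m hm k => ?_⟩
  refine fold_of_mem (fun l => classMat st.n (removeArc st.mat e.1 e.2.1) m k ∈ l) hm
    (fun l => ?_) fun m l hl => ?_
  · simp only [force_eq]
    cases k <;> simp
  · simp only [force_eq]
    simp [hl]

theorem Realizes.fits_del (hc : Critical a φ) {st : State} {f : ℕ → V} (h : Realizes a φ st f)
    (hf : ∀ i < st.n, f i ≠ f st.n) {r : ℕ × ℕ} (ho : Bits st.n r.1 fun i => a (f st.n) (f i))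
    (hs : Bits st.n r.2 fun i => a (f i) (f st.n)) {u v m : ℕ} (hu : u < st.n) (hv : v < st.n)
    (huv : a (f u) (f v) = true) (hm : Bits st.n m fun i => φ (f u) (f v) (f i)) :
    fits st.n (removeArc st.mat u v) m (φ (f u) (f v) (f st.n)) (outer st.n r.1 r.2) = true := by
  refine GoodOn.fits (b := fun i j => del a (f u) (f v) (f i) (f j))
    ((hc.good _ _ huv).goodOn _ f) h.le (h.mat_del hc.irrefl hu hv huv) hm
    (ho.congr fun i hi => ?_) (hs.congr fun i hi => ?_)
  · simp [del, (hf _ hu).symm]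
  · simp [del, (hf _ hv).symm]

theorem Realizes.colourable (hc : Critical a φ) {st : State} {f : ℕ → V} (h : Realizes a φ st f)
    (hf : ∀ i < st.n, f i ≠ f st.n) {r : ℕ × ℕ} (ho : Bits st.n r.1 fun i => a (f st.n) (f i))
    (hs : Bits st.n r.2 fun i => a (f i) (f st.n)) :
    colourable st.classes (outer st.n r.1 r.2) = true := by
  rw [DicriticalSearch.colourable, every_eq, List.all_eq_true]
  intro l hl
  obtain ⟨e, he, hl⟩ := exists_mem_classes hl
  obtain ⟨h1, h2, h3, m, hm, h4⟩ := h.cols e he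
  rw [anyOf_eq, List.any_eq_true]
  exact ⟨_, hl m hm (φ (f e.1) (f e.2.1) (f st.n)), h.fits_del hc hf ho hs h1 h2 h3 h4⟩

theorem Realizes.exists_row {st : State} {f : ℕ → V} (h : Realizes a φ st f) {x : V}
    (hx : ∀ i < st.n, f i ≠ x) : ∃ g : ℕ → V, (∀ i < st.n, g i = f i) ∧ g st.n = x ∧
      Realizes a φ st g ∧ (∀ i < st.n, g i ≠ g st.n) ∧ ∃ r ∈ st.cand,
        Bits st.n r.1 (fun i => a (g st.n) (g i)) ∧ Bits st.n r.2 fun i => a (g i) (g st.n) := by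
  obtain ⟨r, hr, h1, h2⟩ := h.cand x hx
  have hg : ∀ i < st.n, Function.update f st.n x i = f i := fun i hi => by
    rw [Function.update_of_ne hi.ne]
  have hgn : Function.update f st.n x st.n = x := Function.update_self ..
  refine ⟨_, hg, hgn, h.congr fun i hi => (hg i hi).symm, fun i hi => ?_, r, hr,
    h1.congr fun i hi => ?_, h2.congr fun i hi => ?_⟩
  · rw [hgn, hg i hi]
    exact hx i hi
  · rw [hgn, hg i hi]
  · rw [hgn, hg i hi]

theorem Realizes.refine (hc : Critical a φ) {tabs : List ℕ} (hclean : Clean a tabs) {st : State}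
    {f : ℕ → V} (h : Realizes a φ st f) : Realizes a φ (st.refine (tabs.drop 2)) f := by
  refine ⟨h.le, h.inj, h.mat, h.proper, h.cols, fun x hx => ?_⟩
  obtain ⟨g, hg, rfl, h', hx', r, hr, h1, h2⟩ := h.exists_row hx
  refine ⟨r, ?_, h1.congr fun i hi => by rw [hg i hi], h2.congr fun i hi => by rw [hg i hi]⟩
  have hinj : ∀ i < st.n + 1, ∀ j < st.n + 1, g i = g j → i = j := by
    intro i hi j hj hij
    rcases Nat.lt_succ_iff_lt_or_eq.1 hi with hi | rfl <;>
      rcases Nat.lt_succ_iff_lt_or_eq.1 hj with hj | rfl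
    · exact h'.inj i hi j hj hij
    · exact absurd hij (hx' i hi)
    · exact absurd hij.symm (hx' j hj)
    · rfl
  rw [State.refine, keep_eq, List.mem_filter]
  refine ⟨hr, ?_⟩
  rw [avoids_patterns (b := fun i j => a (g i) (g j)) h'.le h'.mat h1 h2 fun M hM hnd => ?_,
    sel_true, force_eq, h'.colourable hc hx' h1 h2]
  rw [← code_map, ← List.length_map (f := g)]
  exact hclean _ (List.Nodup.map_on (fun i hi j hj => hinj i (hM i hi) j (hM j hj)) hnd)

end

/-! ### Soundness of the search -/

theorem upto_all (p : ℕ → Bool) (n : ℕ) :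
    upto (fun x b => sel (p x) b false) true n = true ↔ ∀ x < n, p x = true := by
  induction n with
  | zero => simp [upto_zero]
  | succ n ih =>
    rw [upto_succ]
    refine ⟨fun h x hx => ?_, fun h => ?_⟩
    · cases hp : p n <;> rw [hp] at h
      · exact absurd h (by simp)
      · rcases Nat.lt_succ_iff_lt_or_eq.1 hx with hx | rfl
        · exact ih.1 h x hx
        · exact hp
    · rw [h n (Nat.lt_succ_self n), sel_true]
      exact ih.2 fun x hx => h x (hx.trans (Nat.lt_succ_self n))

theorem goodOn_of_isProper {n A ψ : ℕ} {b : ℕ → ℕ → Bool} {c : ℕ → Bool} (hn : n ≤ 16)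
    (hA : Mat n A (withDiag b)) (hb : ∀ i, b i i = false) (hψ : Bits n ψ c)
    (h : isProper n A ψ = true) : GoodOn n b c := by
  intro x hx y hy z hz h1 h2 h3 h4 h5
  have hout : Bits n (outMask n A x) (b x) := by
    refine upto_setBit _ fun y hy s => ?_
    rw [hA.arcAt hn hx hy, withDiag]
    by_cases hxy : x = y
    · subst hxy
      simp [hb]
    · rw [show Nat.beq x y = false by simpa [← Bool.not_eq_true, Nat.beq_eq] using hxy]
      simp [hxy]
  have hin : Bits n (inMask n A x) fun y => b y x := by
    refine upto_setBit _ fun y hy s => ?_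
    rw [hA.arcAt hn hy hx, withDiag]
    by_cases hxy : x = y
    · subst hxy
      simp [hb]
    · rw [show Nat.beq x y = false by simpa [← Bool.not_eq_true, Nat.beq_eq] using hxy]
      simp [Ne.symm hxy]
  have hf := (upto_all _ n).1 h x hx
  rw [bitAt_eq, hψ.apply hx, fits_iff hn hA hψ _ hout hin] at hf
  exact hf y hy z hz h4.symm (h5.symm.trans h4.symm) h2 h1 h3

theorem mem_triangles {st : State} {n u v m x : ℕ} {k : Bool} {l : List State} {q : ℕ × ℕ}
    (hq : q ∈ st.cand) (h1 : q.1.testBit x = true) (h2 : q.2.testBit n = true)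
    (h3 : fits st.n (removeArc st.mat u v) m k (outer st.n q.1 q.2) = true) :
    st.push u v m q k ∈ st.triangles n u v m k x l := by
  refine fold_of_mem (fun l => st.push u v m q k ∈ l) hq (fun l => ?_) fun q l hl => ?_
  · simp [h1, h2, h3]
  · cases bitAt q.1 x
    · exact hl
    cases bitAt q.2 n
    · exact hl
    cases fits st.n (removeArc st.mat u v) m k (outer st.n q.1 q.2)
    · exact hl
    · exact List.mem_cons_of_mem _ hl

theorem mem_triangles_of_mem {st s : State} {n u v m x : ℕ} {k : Bool} {l : List State}
    (hs : s ∈ l) : s ∈ st.triangles n u v m k x l := by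
  refine fold_induction (fun l => s ∈ l) hs fun q _ l hl => ?_
  cases bitAt q.1 x
  · exact hl
  cases bitAt q.2 n
  · exact hl
  cases fits st.n (removeArc st.mat u v) m k (outer st.n q.1 q.2)
  · exact hl
  · exact List.mem_cons_of_mem _ hl

theorem mem_child_of_mem {st s : State} {tabs : List ℕ} {u v m ψ Q : ℕ} {r : ℕ × ℕ} {k : Bool}
    {l : List State} (hs : s ∈ l) : s ∈ st.child tabs u v m ψ r Q k l := by
  rw [State.child]
  cases fits st.n (removeArc st.mat u v) m k Q
  · exact hs
  cases fits st.n st.mat ψ k Q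
  · exact List.mem_cons_of_mem _ hs
  · refine upto_induction (fun l => s ∈ l) hs fun x _ l hl => ?_
    cases bitAt r.2 x
    · exact hl
    cases bitAt (Nat.xor ψ m) x
    · exact hl
    cases bitAt (colourClass st.n ψ k) x
    · exact hl
    · exact mem_triangles_of_mem hl

theorem push_mem_child {st : State} {tabs : List ℕ} {u v m ψ Q : ℕ} {r : ℕ × ℕ} {k : Bool}
    {l : List State} (h1 : fits st.n (removeArc st.mat u v) m k Q = true)
    (h2 : fits st.n st.mat ψ k Q = false) :
    st.push u v m r k ∈ st.child tabs u v m ψ r Q k l := by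
  rw [State.child, h1, h2]
  exact List.mem_cons_self

theorem triangle_mem_child {st s : State} {tabs : List ℕ} {u v m ψ Q x : ℕ} {r : ℕ × ℕ} {k : Bool}
    {l : List State} (h1 : fits st.n (removeArc st.mat u v) m k Q = true)
    (h2 : fits st.n st.mat ψ k Q = true) (hx : x < st.n) (hr : r.2.testBit x = true)
    (hψ : (ψ.testBit x ^^ m.testBit x) = true) (hk : (colourClass st.n ψ k).testBit x = true)
    (hs : ∀ l, s ∈ ((st.push u v m r k).refine tabs).triangles st.n u v
      (sel k (setBit m st.n) m) k x l) : s ∈ st.child tabs u v m ψ r Q k l := by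
  rw [State.child, h1, h2]
  have hψ' : (Nat.xor ψ m).testBit x = true := by rw [← hψ]; exact Nat.testBit_xor ψ m x
  refine upto_of_lt (fun l => s ∈ l) hx (fun l => ?_) fun x l hl => ?_
  · simp only [bitAt_eq, hr, hψ', hk, sel_true]
    exact hs l
  · cases bitAt r.2 x
    · exact hl
    cases bitAt (Nat.xor ψ m) x
    · exact hl
    cases bitAt (colourClass st.n ψ k) x
    · exact hl
    · exact mem_triangles_of_mem hl

theorem mem_children {st s : State} {tabs : List ℕ} {u v m ψ : ℕ} {r : ℕ × ℕ} (hr : r ∈ st.cand)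
    (k : Bool) (hs : ∀ l, s ∈ st.child tabs u v m ψ r (outer st.n r.1 r.2) k l) :
    s ∈ st.children tabs u v m ψ := by
  refine fold_of_mem (fun l => s ∈ l) hr (fun l => ?_) fun r l hl => ?_
  · rw [force_eq]
    cases k
    · exact hs _
    · exact mem_child_of_mem (hs _)
  · rw [force_eq]
    exact mem_child_of_mem (mem_child_of_mem hl)

section

variable {V : Type} {a : V → V → Bool} {φ : V → V → V → Bool}

theorem Realizes.bits_push {st : State} {f : ℕ → V} {u v m : ℕ}
    (hm : Bits st.n m fun i => φ (f u) (f v) (f i)) :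
    Bits (st.n + 1) (sel (φ (f u) (f v) (f st.n)) (DicriticalSearch.setBit m st.n) m)
      fun i => φ (f u) (f v) (f i) := by
  cases hk : φ (f u) (f v) (f st.n)
  · exact hm.succ hk
  · exact hm.setBit hk

theorem Realizes.push (hc : Critical a φ) {st : State} {f : ℕ → V} (h : Realizes a φ st f)
    (hn : st.n < 16) (hf : ∀ i < st.n, f i ≠ f st.n) {r : ℕ × ℕ}
    (ho : Bits st.n r.1 fun i => a (f st.n) (f i)) (hs : Bits st.n r.2 fun i => a (f i) (f st.n))
    {u v m : ℕ} (hm : Bits st.n m fun i => φ (f u) (f v) (f i)) :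
    Realizes a φ (st.push u v m r (φ (f u) (f v) (f st.n))) f :=
  (h.extend hc hn hf ho hs).commit fun _ _ => by
    rw [State.extend, force_eq]
    exact Realizes.bits_push hm

/-- A colouring that is proper after removal of `p → q` has no monochromatic digon or triangle
avoiding that arc. -/
theorem Critical.false_of_mono (hc : Critical a φ) {p q x y z : V} (hpq : a p q = true)
    (h1 : a x y = true) (h2 : y = z ∨ a y z = true) (h3 : a z x = true)
    (hxy : φ p q x = φ p q y) (hyz : φ p q y = φ p q z) (h1' : x ≠ p ∨ y ≠ q)
    (h2' : y ≠ p ∨ z ≠ q) (h3' : z ≠ p ∨ x ≠ q) : False := by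
  have key : ∀ {x y : V}, a x y = true → x ≠ p ∨ y ≠ q → del a p q x y = true := by
    rintro x y h (h' | h') <;> simp [del, h, h']
  exact hc.good p q hpq x y z (key h1 h1') (h2.imp id fun h => key h h2') (key h3 h3') hxy hyz

/-- If the colouring `φ p q` is changed on a set in which this creates no monochromatic digon or
triangle, then there is a monochromatic digon or triangle with one or two vertices outside. -/
theorem Critical.exists_mono (hc : Critical a φ) {p q : V} (hpq : a p q = true) {S : Set V}
    (hp : p ∈ S) (c : V → Bool) (hcS : ∀ x ∉ S, c x = φ p q x)
    (hS : ∀ x ∈ S, ∀ y ∈ S, ∀ z ∈ S, a x y = true → (y = z ∨ a y z = true) → a z x = true →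
      c x = c y → c y = c z → False) :
    (∃ x ∉ S, ∃ y ∈ S, ∃ z ∈ S, a x y = true ∧ (y = z ∨ a y z = true) ∧ a z x = true ∧
      c y = φ p q x ∧ c z = φ p q x) ∨
    ∃ x ∈ S, ∃ y ∉ S, ∃ z ∉ S, y ≠ z ∧ a x y = true ∧ a y z = true ∧ a z x = true ∧
      c x = φ p q y ∧ φ p q z = φ p q y := by
  have hrot : ∃ x ∉ S, ∃ y z, a x y = true ∧ (y = z ∨ a y z = true) ∧ a z x = true ∧
      c x = c y ∧ c y = c z := by
    have hng := hc.not_good c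
    simp only [Good, not_forall] at hng
    obtain ⟨x, y, z, h1, h2, h3, h4, h5, -⟩ := hng
    by_cases hx : x ∈ S
    · by_cases hy : y ∈ S
      · by_cases hz : z ∈ S
        · exact (hS x hx y hy z hz h1 h2 h3 h4 h5).elim
        · have hyz : a y z = true := h2.resolve_left fun h => hz (h ▸ hy)
          exact ⟨z, hz, x, y, h3, .inr h1, hyz, (h4.trans h5).symm, h4⟩
      · rcases h2 with rfl | h2
        · exact ⟨y, hy, x, x, h3, .inl rfl, h1, h4.symm, rfl⟩
        · exact ⟨y, hy, z, x, h2, .inr h3, h1, h5, (h4.trans h5).symm⟩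
    · exact ⟨x, hx, y, z, h1, h2, h3, h4, h5⟩
  obtain ⟨x, hx, y, z, h1, h2, h3, h4, h5⟩ := hrot
  have hxp : x ≠ p := fun h => hx (h ▸ hp)
  rw [hcS x hx] at h4
  by_cases hy : y ∈ S
  · by_cases hz : z ∈ S
    · exact .inl ⟨x, hx, y, hy, z, hz, h1, h2, h3, h4.symm, (h4.trans h5).symm⟩
    · have hyz : a y z = true := h2.resolve_left fun h => hz (h ▸ hy)
      rw [hcS z hz] at h5
      refine .inr ⟨y, hy, z, hz, x, hx, ?_, hyz, h3, h1, h5, h4.trans h5⟩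
      rintro rfl
      simp [hc.irrefl] at h3
  · rw [hcS y hy] at h4 h5
    by_cases hz : z ∈ S
    · have hyz : a y z = true := h2.resolve_left fun h => hy (h ▸ hz)
      refine .inr ⟨z, hz, x, hx, y, hy, ?_, h3, h1, hyz, (h4.trans h5).symm, h4.symm⟩
      rintro rfl
      simp [hc.irrefl] at h1
    · rw [hcS z hz] at h5
      exact (hc.false_of_mono hpq h1 h2 h3 h4 h5 (.inl hxp) (.inl fun h => hy (h ▸ hp))
        (.inl fun h => hz (h ▸ hp))).elim

theorem Realizes.exists_mem_children (hc : Critical a φ) {tabs : List ℕ} (hclean : Clean a tabs)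
    {st : State} {f : ℕ → V} (h : Realizes a φ st f) (hn : st.n ≤ 14) {u v m ψ : ℕ}
    (hu : u < st.n) (hv : v < st.n) (huv : a (f u) (f v) = true)
    (hm : Bits st.n m fun i => φ (f u) (f v) (f i)) (hψ : ψ < 2 ^ st.n)
    (hproper : isProper st.n st.mat ψ = true) :
    ∃ s ∈ st.children (tabs.drop 2) u v m ψ, ∃ g, Realizes a φ s g := by
  classical
  have hψ' : Bits st.n ψ ψ.testBit := fun i => by
    by_cases hi : i < st.n
    · simp [hi]
    · rw [Nat.testBit_lt_two_pow (hψ.trans_le (Nat.pow_le_pow_right (by omega) (not_lt.1 hi)))]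
      simp
  have hgood := goodOn_of_isProper h.le h.mat (fun i => hc.irrefl (f i)) hψ' hproper
  let c : V → Bool := fun w =>
    if hw : ∃ i < st.n, f i = w then ψ.testBit hw.choose else φ (f u) (f v) w
  have hc1 : ∀ i < st.n, c (f i) = ψ.testBit i := by
    intro i hi
    have hw : ∃ j < st.n, f j = f i := ⟨i, hi, rfl⟩
    simp only [c]
    rw [dif_pos hw, h.inj _ hw.choose_spec.1 _ hi hw.choose_spec.2]
  have hc2 : ∀ w, w ∉ {w | ∃ i < st.n, f i = w} → c w = φ (f u) (f v) w := fun w hw => dif_neg hw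
  rcases hc.exists_mono huv (S := {w | ∃ i < st.n, f i = w}) ⟨u, hu, rfl⟩ c hc2 (by
    rintro _ ⟨x, hx, rfl⟩ _ ⟨y, hy, rfl⟩ _ ⟨z, hz, rfl⟩ h1 h2 h3
    rw [hc1 x hx, hc1 y hy, hc1 z hz]
    exact hgood x hx y hy z hz h1 (h2.imp (h.inj y hy z hz) id) h3) with
    ⟨x, hx, _, ⟨i, hi, rfl⟩, _, ⟨j, hj, rfl⟩, h1, h2, h3, h4, h5⟩ |
    ⟨_, ⟨i, hi, rfl⟩, x, hx, y, hy, hxy, h1, h2, h3, h4, h5⟩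
  · have hx' : ∀ i < st.n, f i ≠ x := fun i hi hix => hx ⟨i, hi, hix⟩
    rw [hc1 i hi] at h4
    rw [hc1 j hj] at h5
    obtain ⟨g, hg, rfl, hgr, hgn, r, hr, ho, hs⟩ := h.exists_row hx'
    rw [← hg u hu, ← hg v hv] at huv hm h4 h5
    rw [← hg i hi] at h1 h2
    rw [← hg j hj] at h2 h3
    have hm' := hm.congr (q := fun i => φ (g u) (g v) (g i)) fun i hi => by rw [hg i hi]
    refine ⟨_, mem_children hr _ fun l => push_mem_child
      (hgr.fits_del hc hgn ho hs hu hv huv hm') ?_, g, hgr.push hc (by omega) hgn ho hs hm'⟩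
    rw [← Bool.not_eq_true, fits_iff hgr.le hgr.mat hψ' _ ho hs]
    exact fun hfit => hfit i hi j hj h4 h5 (h2.imp (hgr.inj i hi j hj) id) h1 h3
  · have hx' : ∀ i < st.n, f i ≠ x := fun i hi hix => hx ⟨i, hi, hix⟩
    have hy' : ∀ i < st.n, f i ≠ y := fun i hi hiy => hy ⟨i, hi, hiy⟩
    rw [hc1 i hi] at h4
    have hne : φ (f u) (f v) (f i) ≠ ψ.testBit i := fun hk =>
      hc.false_of_mono huv h1 (.inr h2) h3 (hk.trans h4) h5.symm (.inr (hx' v hv).symm)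
        (.inl (hx' u hu).symm) (.inl (hy' u hu).symm)
    obtain ⟨g, hg, rfl, hgr, hgn, r, hr, ho, hs⟩ := h.exists_row hx'
    rw [← hg u hu, ← hg v hv] at huv hm h4 h5 hne
    rw [← hg i hi] at h1 h3 hne
    have hm' := hm.congr (q := fun i => φ (g u) (g v) (g i)) fun i hi => by rw [hg i hi]
    have hfit := hgr.fits_del hc hgn ho hs hu hv huv hm'
    have hpush := hgr.push hc (by omega) hgn ho hs hm'
    cases hfit' : fits st.n st.mat ψ (φ (g u) (g v) (g st.n)) (outer st.n r.1 r.2)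
    · exact ⟨_, mem_children hr _ fun l => push_mem_child hfit hfit', g, hpush⟩
    · have href := hpush.refine hc hclean
      generalize hk : φ (g u) (g v) (g st.n) = k at *
      have hsn : ((st.push u v m r k).refine (tabs.drop 2)).n = st.n + 1 := by
        simp only [State.refine, State.push, State.commit, State.extend, force_eq]
      have hgy : ∀ j < ((st.push u v m r k).refine (tabs.drop 2)).n, g j ≠ y := by
        rw [hsn]
        intro j hj
        rcases Nat.lt_succ_iff_lt_or_eq.1 hj with hj | rfl
        · rw [hg j hj]
          exact hy' j hj
        · exact hxy
      obtain ⟨g', hg', rfl, hgr', hgn', q, hq, ho', hs'⟩ := href.exists_row hgy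
      have hsub : ∀ i < st.n, g' i = g i := fun i hi => hg' i (by rw [hsn]; omega)
      have hbits : Bits ((st.push u v m r k).refine (tabs.drop 2)).n
          (sel k (DicriticalSearch.setBit m st.n) m) fun i => φ (g' u) (g' v) (g' i) := by
        have := Realizes.bits_push hm'
        rw [hk] at this
        rw [hsub u hu, hsub v hv]
        rw [← hsn] at this
        exact this.congr fun j hj => by rw [hg' j hj]
      have hu' : u < ((st.push u v m r k).refine (tabs.drop 2)).n := by omega
      have hv' : v < ((st.push u v m r k).refine (tabs.drop 2)).n := by omega
      have hi' : i < ((st.push u v m r k).refine (tabs.drop 2)).n := by omega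
      have hn' : st.n < ((st.push u v m r k).refine (tabs.drop 2)).n := by omega
      rw [← hsub u hu, ← hsub v hv] at huv h5
      rw [← hg' st.n hn'] at h2
      rw [← hsub i hi] at h3
      have hfit'' := hgr'.fits_del hc hgn' ho' hs' hu' hv' huv hbits
      have hpush' := hgr'.push hc (by omega) hgn' ho' hs' hbits
      rw [h5] at hfit'' hpush'
      refine ⟨_, mem_children hr _ fun l => triangle_mem_child hfit hfit' hi ?_ ?_ ?_
        fun l => mem_triangles hq ?_ ?_ hfit'', g', hpush'⟩
      · rw [hs.apply hi, h1]
      · rw [hm'.apply hi]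
        cases h6 : ψ.testBit i <;> cases h7 : φ (g u) (g v) (g i) <;> simp [h6, h7] at hne ⊢
      · rw [(hψ'.colourClass k).apply hi, h4]
        simp
      · rw [ho'.apply hi', h3]
      · rw [hs'.apply hn', h2]

end

section

variable {V : Type} {a : V → V → Bool} {φ : V → V → V → Bool}

/-- The vertices `g 0, g 1, …` induce the digraph with out-neighbourhoods `T`. -/
def Embeds (a : V → V → Bool) (T : List ℕ) (g : ℕ → V) : Prop :=
  ∀ i < T.length, ∀ j < T.length, i ≠ j → g i ≠ g j ∧ a (g i) (g j) = (T.getD i 0).testBit j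

theorem embeds_of_matchesAt {n A : ℕ} {T p : List ℕ} {f : ℕ → V} (hn : n ≤ 16)
    (hA : Mat n A (withDiag fun i j => a (f i) (f j)))
    (hf : ∀ i < n, ∀ j < n, f i = f j → i = j) (h : matchesAt n A T p = true) :
    Embeds a T fun k => f (p.getD k 0) := by
  rw [matchesAt, List.all_eq_true] at h
  have hlt : ∀ i < T.length, p.getD i 0 < n := fun i hi => by
    have := h i (List.mem_range.2 hi)
    rw [Bool.and_eq_true] at this
    exact Nat.le_of_ble_eq_true this.1
  intro i hi j hj hij
  have h' := h i (List.mem_range.2 hi)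
  rw [Bool.and_eq_true, List.all_eq_true] at h'
  have h2 := h'.2 j (List.mem_range.2 hj)
  rw [show Nat.beq i j = false by simpa [← Bool.not_eq_true, Nat.beq_eq] using hij,
    Bool.false_or, Bool.and_eq_true, hA.arcAt hn (hlt i hi) (hlt j hj), bitAt_eq, withDiag] at h2
  have hne : p.getD i 0 ≠ p.getD j 0 := by
    intro he
    have := h2.1
    rw [he] at this
    simp at this
  refine ⟨fun he => hne (hf _ (hlt i hi) _ (hlt j hj) he), ?_⟩
  have := h2.2
  simpa only [hne, decide_false, Bool.false_or, beq_iff_eq] using this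

theorem exists_of_runAll {next : State → List Instr → Option (List Instr)} {sts : List State}
    {l l' : List Instr} (h : runAll next sts l = some l') {st : State} (hst : st ∈ sts) :
    ∃ l₁ l₂, next st l₁ = some l₂ := by
  induction sts generalizing l with
  | nil => simp at hst
  | cons s sts ih =>
    rw [runAll, fold_cons] at h
    cases hs : next s l with
    | none => simp [hs] at h
    | some l₁ =>
      rcases List.mem_cons.1 hst with rfl | hst
      · exact ⟨l, l₁, hs⟩
      · rw [hs] at h
        exact ih h hst

/-- No target is induced by vertices of `a`. -/
def Avoids (a : V → V → Bool) (targets : List (List ℕ)) : Prop := ∀ T ∈ targets, ∀ g, ¬ Embeds a T g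

theorem not_realizes_of_process (hc : Critical a φ) {targets : List (List ℕ)}
    (ht : Avoids a targets) {tabs : List ℕ} (hclean : Clean a tabs)
    {next : State → List Instr → Option (List Instr)}
    (hnext : ∀ st l l', next st l = some l' → ∀ f, ¬ Realizes a φ st f) {st : State}
    {l l' : List Instr} (h : process targets (tabs.drop 2) next st l = some l') (f : ℕ → V) :
    ¬ Realizes a φ st f := by
  intro hr
  cases l with
  | nil => simp [process] at h
  | cons i l =>
    cases i with
    | found t p =>
      rw [process] at h
      cases hm : Nat.blt t targets.length && matchesAt st.n st.mat (targets.getD t []) p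
      · rw [hm] at h
        simp at h
      · rw [Bool.and_eq_true] at hm
        have hlt : t < targets.length := Nat.le_of_ble_eq_true hm.1
        refine ht (targets.getD t []) ?_ _ (embeds_of_matchesAt hr.le hr.mat hr.inj hm.2)
        rw [List.getD_eq_getElem _ _ hlt]
        exact List.getElem_mem hlt
    | split u v =>
      rw [process] at h
      cases hm : st.masks u v with
      | nil => simp [hm] at h
      | cons m ms =>
        simp only [hm] at h
        rw [← hm, fold_map] at h
        obtain ⟨-, -, -, m', hm', hb⟩ := hr.exists_mem_masks (u := u) (v := v) (by simp [hm])
        obtain ⟨l₁, l₂, hn⟩ := exists_of_runAll h (List.mem_map_of_mem hm')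
        exact hnext _ _ _ hn f (hr.commit fun _ _ => hb)
    | step u v ψ =>
      rw [process] at h
      split at h
      · next m hm =>
        obtain ⟨hu, hv, huv, m', hm', hb⟩ := hr.exists_mem_masks (u := u) (v := v) (by simp [hm])
        rw [hm, List.mem_singleton] at hm'
        subst hm'
        cases h1 : Nat.ble st.n 14 && (Nat.blt ψ (Nat.pow 2 st.n) && isProper st.n st.mat ψ)
        · rw [h1] at h
          simp at h
        · rw [h1, sel_true] at h
          rw [Bool.and_eq_true, Bool.and_eq_true] at h1
          obtain ⟨s, hs, g, hg⟩ := hr.exists_mem_children hc hclean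
            (Nat.le_of_ble_eq_true h1.1) hu hv huv hb (Nat.le_of_ble_eq_true h1.2.1) h1.2.2
          obtain ⟨l₁, l₂, hn⟩ := exists_of_runAll h hs
          exact hnext _ _ _ hn g hg
      · simp at h

theorem not_realizes_of_run (hc : Critical a φ) {targets : List (List ℕ)}
    (ht : Avoids a targets) {tabs : List ℕ} (hclean : Clean a tabs) (fuel : ℕ) {st : State}
    {l l' : List Instr} (h : run targets tabs fuel st l = some l') (f : ℕ → V) :
    ¬ Realizes a φ st f := by
  induction fuel generalizing st l l' f with
  | zero => simp [run, upto_zero] at h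
  | succ fuel ih =>
    intro hr
    have e : run targets tabs (fuel + 1) st l =
      sel (anyOf (fun e => List.isEmpty e.2.2) st.cols) (some l)
        (process targets (tabs.drop 2) (run targets tabs fuel) (st.refine (tabs.drop 2)) l) := rfl
    rw [e] at h
    cases he : anyOf (fun e : ℕ × ℕ × List ℕ => List.isEmpty e.2.2) st.cols
    · rw [he, sel_false] at h
      exact not_realizes_of_process hc ht hclean (fun st l l' hl f => ih hl f) h f
        (hr.refine hc hclean)
    · rw [anyOf_eq, List.any_eq_true] at he
      obtain ⟨e, he, hemp⟩ := he
      obtain ⟨-, -, -, m, hm, -⟩ := hr.cols e he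
      rw [List.isEmpty_iff] at hemp
      simp [hemp] at hm

theorem adj_of_isSemiComplete {R : List ℕ} (h : isSemiComplete R = true) {i j : ℕ}
    (hi : i < R.length) (hj : j < R.length) (hij : i ≠ j) :
    (R.getD i 0).testBit j = true ∨ (R.getD j 0).testBit i = true := by
  rw [isSemiComplete, List.all_eq_true] at h
  have h1 := h i (List.mem_range.2 hi)
  rw [List.all_eq_true] at h1
  have h2 := h1 j (List.mem_range.2 hj)
  rw [show Nat.beq i j = false by simpa [← Bool.not_eq_true, Nat.beq_eq] using hij] at h2
  simpa using h2

theorem Embeds.realizes_seedState (hc : Critical a φ) {tabs R : List ℕ} (hclean : Clean a tabs)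
    (hR : R.length ≤ 16) {f : ℕ → V} (h : Embeds a R f) (i : ℕ) (hi : i ≤ R.length) :
    (seedState tabs R i).n = i ∧ Realizes a φ (seedState tabs R i) f := by
  induction i with
  | zero => exact ⟨rfl, realizes_empty f⟩
  | succ i ih =>
    obtain ⟨hn, hr⟩ := ih (by omega)
    have hr' := hr.refine hc hclean
    have hn' : ((seedState tabs R i).refine (tabs.drop 2)).n = i := hn
    refine ⟨by simp [seedState, State.extend, hn'], ?_⟩
    rw [seedState]
    refine hr'.extend hc (by omega) (fun j hj => ?_) ?_ ?_
    · rw [hn'] at hj ⊢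
      exact (h j (by omega) i (by omega) (by omega)).1
    · rw [hn']
      exact upto_setBit _ fun j hj s => by
        rw [bitAt_eq, (h i (by omega) j (by omega) (by omega)).2]
    · rw [hn']
      exact upto_setBit _ fun j hj s => by
        rw [bitAt_eq, (h j (by omega) i (by omega) (by omega)).2]

theorem digit_inj {p q p' q' : Bool} (h : p = true ∨ q = true) (h' : p' = true ∨ q' = true)
    (hd : digit p q = digit p' q') : p = p' ∧ q = q' := by
  revert h h' hd
  cases p <;> cases q <;> cases p' <;> cases q' <;> decide

theorem rowCode_inj {α : Type} {d e : α → ℕ} {l : List α} (hd : ∀ x ∈ l, d x < 3)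
    (he : ∀ x ∈ l, e x < 3) (h : rowCode d l = rowCode e l) : ∀ x ∈ l, d x = e x := by
  induction l with
  | nil => simp
  | cons x l ih =>
    rw [rowCode_cons, rowCode_cons] at h
    have h1 := hd x (by simp)
    have h2 := he x (by simp)
    intro y hy
    rcases List.mem_cons.1 hy with rfl | hy
    · omega
    · exact ih (fun z hz => hd z (by simp [hz])) (fun z hz => he z (by simp [hz])) (by omega) y hy

theorem eq_of_code_eq {α : Type} {A B : α → α → Bool} {l : List α} (hl : l.Nodup)
    (hA : ∀ x ∈ l, ∀ y ∈ l, x ≠ y → A x y = true ∨ A y x = true)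
    (hB : ∀ x ∈ l, ∀ y ∈ l, x ≠ y → B x y = true ∨ B y x = true)
    (h : code A l = code B l) : ∀ x ∈ l, ∀ y ∈ l, x ≠ y → A x y = B x y := by
  induction l with
  | nil => simp
  | cons x l ih =>
    rw [List.nodup_cons] at hl
    rw [code_cons, code_cons] at h
    have hlt : ∀ C : α → α → Bool, rowCode (fun i => digit (C x i) (C i x)) l < 3 ^ l.length :=
      fun C => rowCode_lt fun y _ => digit_lt _ _
    have hpos : 0 < 3 ^ l.length := by positivity
    have h1 : rowCode (fun i => digit (A x i) (A i x)) l =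
        rowCode (fun i => digit (B x i) (B i x)) l := by
      have := congrArg (· % 3 ^ l.length) h
      simpa [Nat.mod_eq_of_lt (hlt A), Nat.mod_eq_of_lt (hlt B)] using this
    have h2 : code A l = code B l := by
      rw [h1, Nat.add_left_cancel_iff] at h
      exact Nat.eq_of_mul_eq_mul_left hpos h
    have hx : ∀ y ∈ l, A x y = B x y ∧ A y x = B y x := fun y hy => by
      have hxy : x ≠ y := fun h => hl.1 (h ▸ hy)
      exact digit_inj (hA x (by simp) y (by simp [hy]) hxy) (hB x (by simp) y (by simp [hy]) hxy)
        (rowCode_inj (fun _ _ => digit_lt _ _) (fun _ _ => digit_lt _ _) h1 y hy)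
    have ih' := ih hl.2 (fun y hy z hz => hA y (by simp [hy]) z (by simp [hz]))
      (fun y hy z hz => hB y (by simp [hy]) z (by simp [hz])) h2
    intro y hy z hz hyz
    rcases List.mem_cons.1 hy with hy | hy <;> rcases List.mem_cons.1 hz with hz | hz
    · exact absurd (hy.trans hz.symm) hyz
    · exact hy ▸ (hx z hz).1
    · exact hz ▸ (hx y hy).2
    · exact ih' y hy z hz hyz

end

section

variable {V : Type} {a : V → V → Bool} {φ : V → V → V → Bool}

theorem exists_embeds_of_code_eq [Nonempty V] (hc : Critical a φ) {R : List ℕ}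
    (hR : isSemiComplete R = true) {L : List ℕ} (hL : L.Perm (List.range R.length)) {M : List V}
    (hM : M.Nodup) (hlen : M.length = R.length)
    (h : code (fun i j => bitAt (R.getD i 0) j) L = code a M) : ∃ g, Embeds a R g := by
  have hnd : L.Nodup := hL.nodup_iff.2 List.nodup_range
  have hlen' : L.length = R.length := by rw [hL.length_eq, List.length_range]
  have hmem : ∀ i, i ∈ L ↔ i < R.length := fun i => by rw [hL.mem_iff, List.mem_range]
  let g : ℕ → V := fun i => M.getD (L.idxOf i) (Classical.arbitrary V)
  have hMg : M = L.map g := by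
    refine List.ext_getElem (by simp [hlen, hlen']) fun k h1 h2 => ?_
    have hk : k < L.length := by omega
    rw [List.getElem_map]
    simp only [g]
    rw [hnd.idxOf_getElem k hk, List.getD_eq_getElem _ _ h1]
  have hinj : ∀ i ∈ L, ∀ j ∈ L, g i = g j → i = j := by
    rw [hMg] at hM
    exact fun i hi j hj hij => List.inj_on_of_nodup_map hM hi hj hij
  rw [hMg, code_map] at h
  have hadj := eq_of_code_eq hnd (fun i hi j hj hij => by
    rw [bitAt_eq, bitAt_eq]
    exact adj_of_isSemiComplete hR ((hmem i).1 hi) ((hmem j).1 hj) hij)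
    (fun i hi j hj hij => hc.total _ _ fun hg => hij (hinj i hi j hj hg)) h
  refine ⟨g, fun i hi j hj hij => ⟨fun hg => hij (hinj i ((hmem i).2 hi) j ((hmem j).2 hj) hg), ?_⟩⟩
  rw [← hadj i ((hmem i).2 hi) j ((hmem j).2 hj) hij, bitAt_eq]

theorem Clean.forbid [Nonempty V] (hc : Critical a φ) {tabs R : List ℕ} (hclean : Clean a tabs)
    (hR : isSemiComplete R = true) (hemb : ∀ g, ¬ Embeds a R g) : Clean a (forbid tabs R) := by
  intro M hM
  have h0 := hclean M hM
  by_cases hlen : M.length = R.length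
  · rw [DicriticalSearch.forbid, List.getD_eq_getElem?_getD, List.getElem?_modify]
    rw [List.getD_eq_getElem?_getD] at h0
    cases ht : tabs[M.length]? with
    | none => simp
    | some T =>
      rw [ht] at h0
      rw [Option.map_eq_map, Option.map_some, Option.getD_some, if_pos hlen.symm]
      refine fold_induction (fun T : ℕ => T.testBit (code a M) = false) h0 fun L hL T ih => ?_
      rw [testBit_setBit, ih, Bool.false_or, decide_eq_false_iff_not]
      intro h
      obtain ⟨g, hg⟩ := exists_embeds_of_code_eq hc hR (List.mem_permutations'.1 hL) hM hlen h
      exact hemb g hg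
  · rw [DicriticalSearch.forbid, List.getD_eq_getElem?_getD, List.getElem?_modify]
    simpa [List.getD_eq_getElem?_getD, Ne.symm hlen] using h0

theorem not_embeds_of_exclude [Nonempty V] (hc : Critical a φ) {targets : List (List ℕ)}
    (ht : Avoids a targets) {prog : List (List ℕ × List Instr)} {tabs : List ℕ}
    (hclean : Clean a tabs) (h : exclude targets tabs prog = true) :
    ∀ e ∈ prog, ∀ g, ¬ Embeds a e.1 g := by
  induction prog generalizing tabs with
  | nil => simp
  | cons e prog ih =>
    obtain ⟨R, l⟩ := e
    rw [exclude] at h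
    simp only [Bool.and_eq_true] at h
    obtain ⟨⟨h1, h2⟩, h3, h4⟩ := h
    have hR : ∀ g, ¬ Embeds a R g := fun g hg => by
      obtain ⟨l', hl'⟩ := Option.isSome_iff_exists.1 h3
      exact not_realizes_of_run hc ht hclean _ hl' g
        (hg.realizes_seedState hc hclean (Nat.le_of_ble_eq_true h1) _ le_rfl).2
    simp only [List.mem_cons, forall_eq_or_imp]
    exact ⟨hR, ih (hclean.forbid hc h2 hR) h4⟩

theorem clean_zero : Clean a [0, 0, 0, 0, 0, 0] := fun M _ => by
  have : [0, 0, 0, 0, 0, 0].getD M.length 0 = 0 := by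
    rcases h : M.length with _ | _ | _ | _ | _ | _ | n <;> simp
  rw [this, Nat.zero_testBit]

end

/-! ### Dicolourings -/

open SimpleDigraph

section

variable {V W : Type}

theorem dicolourable_comap {A : V → V → Prop} (h : Dicolourable2Rel A) {B : W → W → Prop}
    (f : W → V) (hf : ∀ u v, B u v → A (f u) (f v)) : Dicolourable2Rel B := by
  obtain ⟨ψ, hψ⟩ := h
  exact ⟨ψ ∘ f, fun i v hv => hψ i (f v) (hv.lift f fun u w h => ⟨hf u w h.1, h.2⟩)⟩

theorem _root_.SimpleDigraph.Dicritical3.of_iso {D : SimpleDigraph V} {H : SimpleDigraph W}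
    (hH : H.Dicritical3) (h : D.Iso H) : D.Dicritical3 := by
  obtain ⟨e, he⟩ := h
  refine ⟨fun hD => hH.1 (dicolourable_comap hD e.symm fun u v huv => ?_), fun S A hA hne => ?_⟩
  · simpa [he] using huv
  · refine dicolourable_comap (hH.2 (e.symm ⁻¹' S) (fun u v => A (e.symm u) (e.symm v))
      (fun u v huv => ?_) ?_) e fun u v huv => by simpa using huv
    · have := hA _ _ huv
      exact ⟨this.1, this.2.1, by simpa [he] using this.2.2⟩
    · refine hne.imp (fun h h' => h ?_) fun h h' => h ?_
      · ext v
        simpa using Set.ext_iff.1 h' (e v)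
      · ext u v
        simpa [he] using congrFun₂ h' (e u) (e v)

/-- A 3-dicritical digraph has no proper induced subdigraph that is not 2-dicolourable. -/
theorem iso_of_embedding {D : SimpleDigraph V} (hD : D.Dicritical3) {H : SimpleDigraph W}
    (hH : ¬ H.Dicolourable2) (f : W → V) (hf : Function.Injective f)
    (hadj : ∀ i j, H.Adj i j ↔ D.Adj (f i) (f j)) : D.Iso H := by
  have hsurj : Function.Surjective f := by
    rw [← Set.range_eq_univ]
    by_contra hne
    exact hH (dicolourable_comap
      (hD.2 (Set.range f) (fun u v => u ∈ Set.range f ∧ v ∈ Set.range f ∧ D.Adj u v)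
        (fun u v h => h) (Or.inl hne)) f fun u v h => ⟨⟨u, rfl⟩, ⟨v, rfl⟩, (hadj u v).1 h⟩)
  refine ⟨(Equiv.ofBijective f ⟨hf, hsurj⟩).symm, fun u v => ?_⟩
  rw [hadj, ← Equiv.ofBijective_apply f ⟨hf, hsurj⟩, ← Equiv.ofBijective_apply f ⟨hf, hsurj⟩,
    Equiv.apply_symm_apply, Equiv.apply_symm_apply]

open scoped Classical in
theorem dicolourable_of_good {D : SimpleDigraph V} (hsc : D.SemiComplete) {c : V → Bool}
    (hc : Good (fun x y => decide (D.Adj x y)) c) : D.Dicolourable2 := by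
  refine ⟨fun v => if c v then 1 else 0, fun i v hv => ?_⟩
  have hcol : ∀ x y, (if c x then (1 : Fin 2) else 0) = i → (if c y then (1 : Fin 2) else 0) = i →
      c x = c y := fun x y hx hy => by
    subst hx
    cases h1 : c x <;> cases h2 : c y <;> simp_all
  have htrans : ∀ x y z, D.Adj x y → D.Adj y z → c x = c y → c y = c z → D.Adj x z := by
    intro x y z hxy hyz h1 h2
    by_contra hxz
    by_cases h : x = z
    · subst h
      exact hc x y y (by simpa using hxy) (Or.inl rfl) (by simpa using hyz) h1 rfl
    · exact hc x y z (by simpa using hxy) (Or.inr (by simpa using hyz))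
        (by simpa using (hsc x z h).resolve_left hxz) h1 h2
  have key : ∀ w, Relation.TransGen (fun a b => D.Adj a b ∧ (if c a then (1 : Fin 2) else 0) = i ∧
      (if c b then (1 : Fin 2) else 0) = i) v w → D.Adj v w ∧
      (if c v then (1 : Fin 2) else 0) = i ∧ (if c w then (1 : Fin 2) else 0) = i := by
    intro w hw
    induction hw with
    | single h => exact h
    | tail _ h ih =>
      exact ⟨htrans _ _ _ ih.1 h.1 (hcol _ _ ih.2.1 ih.2.2) (hcol _ _ h.2.1 h.2.2), ih.2.1, h.2.2⟩
  exact D.loopless v (key v hv).1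

theorem good_of_dicolouring {b : V → V → Bool} {ψ : V → Fin 2}
    (hψ : ∀ i, AcyclicRel fun u v => b u v = true ∧ ψ u = i ∧ ψ v = i) (k : Fin 2) :
    Good b fun v => decide (ψ v ≠ k) := by
  intro x y z hxy hyz hzx h1 h2
  have heq : ∀ u v, decide (ψ u ≠ k) = decide (ψ v ≠ k) → ψ v = ψ u := fun u v h => by
    rw [decide_eq_decide] at h
    omega
  have hy := heq x y h1
  have hz := heq y z h2
  refine hψ (ψ x) x ?_
  have s1 : Relation.TransGen (fun u v => b u v = true ∧ ψ u = ψ x ∧ ψ v = ψ x) x y :=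
    .single ⟨hxy, rfl, hy⟩
  rcases hyz with rfl | hyz
  · exact s1.tail ⟨hzx, hy, rfl⟩
  · exact (s1.tail ⟨hyz, hy, hz.trans hy⟩).tail ⟨hzx, hz.trans hy, rfl⟩

open scoped Classical in
theorem exists_critical {D : SimpleDigraph V} (hsc : D.SemiComplete) (hD : D.Dicritical3) :
    ∃ φ, Critical (fun x y => decide (D.Adj x y)) φ := by
  have hgood : ∀ c, ¬ Good (fun x y => decide (D.Adj x y)) c := fun c hc =>
    hD.1 (dicolourable_of_good hsc hc)
  have hdel : ∀ p q, D.Adj p q → ∃ c : V → Bool,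
      Good (del (fun x y => decide (D.Adj x y)) p q) c ∧ c p = false ∧ c q = false := by
    intro p q hpq
    obtain ⟨ψ, hψ⟩ := hD.2 Set.univ (fun x y => D.Adj x y ∧ ¬ (x = p ∧ y = q))
      (fun u v h => ⟨trivial, trivial, h.1⟩) (Or.inr fun h => by simpa [hpq] using congrFun₂ h p q)
    have hg : Good (del (fun x y => decide (D.Adj x y)) p q) fun v => decide (ψ v ≠ ψ p) :=
      good_of_dicolouring (fun i v hv => hψ i v (hv.lift id fun x y h => by
        simpa [del, imp_iff_not_or, Function.onFun] using h)) _
    refine ⟨_, hg, by simp, ?_⟩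
    by_contra hq
    have hne : ψ q ≠ ψ p := by simpa using hq
    have hmono : ∀ x y, decide (D.Adj x y) = true →
        decide (ψ x ≠ ψ p) = decide (ψ y ≠ ψ p) →
        del (fun x y => decide (D.Adj x y)) p q x y = true := fun x y h h' => by
      by_cases hx : x = p ∧ y = q
      · obtain ⟨rfl, rfl⟩ := hx
        simp [hne] at h'
      · simpa [del, imp_iff_not_or] using ⟨of_decide_eq_true h, not_and_or.1 hx⟩
    refine hgood _ fun x y z h1 h2 h3 h4 h5 => hg x y z (hmono x y h1 h4) (h2.imp id fun h2 =>
      hmono y z h2 h5) (hmono z x h3 (h4.trans h5).symm) h4 h5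
  choose! φ hφ using hdel
  exact ⟨φ, {
    irrefl := fun x => by simpa using D.loopless x
    total := fun x y hxy => by simpa using hsc x y hxy
    not_good := hgood
    good := fun p q h => (hφ p q (by simpa using h)).1
    left := fun p q h => (hφ p q (by simpa using h)).2.1
    right := fun p q h => (hφ p q (by simpa using h)).2.2 }⟩

theorem exists_embeds [Nonempty V] {a : V → V → Bool} {φ : V → V → V → Bool} (hc : Critical a φ)
    {targets : List (List ℕ)} {prog : List (List ℕ × List Instr)}
    (h : exclude targets [0, 0, 0, 0, 0, 0] prog = true)
    (h1 : [2, 1] ∈ prog.map Prod.fst) (h2 : [0, 1] ∈ prog.map Prod.fst) :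
    ∃ T ∈ targets, ∃ g, Embeds a T g := by
  by_contra! hno
  have hex := not_embeds_of_exclude hc hno clean_zero h
  obtain ⟨e1, he1, hf1⟩ := List.mem_map.1 h1
  obtain ⟨e2, he2, hf2⟩ := List.mem_map.1 h2
  have hpair : ∀ (R : List ℕ) (x y : V), R.length = 2 → x ≠ y → a x y = (R.getD 0 0).testBit 1 →
      a y x = (R.getD 1 0).testBit 0 → Embeds a R fun i => if i = 0 then x else y := by
    intro R x y hR hxy hx hy i hi j hj hij
    rw [hR] at hi hj
    interval_cases i <;> interval_cases j <;> simp_all [Ne.symm hxy]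
  refine hc.not_good (fun _ => false) fun x y z hxy _ _ _ _ => ?_
  have hne : x ≠ y := fun h => by simp [h, hc.irrefl] at hxy
  cases hyx : a y x
  · exact hex e2 he2 _ (hf2 ▸ hpair [0, 1] y x rfl hne.symm hyx hxy)
  · exact hex e1 he1 _ (hf1 ▸ hpair [2, 1] x y rfl hne hxy hyx)

end

open SimpleDigraph

/-- The vertices with an in-neighbour in `s`. -/
def peel (b : ℕ → ℕ → Bool) (s : List ℕ) : List ℕ :=
  s.filter fun i => s.any fun j => b j i

/-- Arcs inside the colour classes of `m`, other than `p → q`. -/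
def monoArc (R : List ℕ) (m p q i j : ℕ) : Bool :=
  (R.getD i 0).testBit j && ((m.testBit i == m.testBit j) && !(Nat.beq i p && Nat.beq j q))

/-- Check that no subset `m` gives a dicolouring, while removing any arc yields a dicolouring
from `masks`. -/
def isCritical (n : ℕ) (R masks : List ℕ) : Bool :=
  ((List.range n).all fun p => (List.range n).any fun q => (R.getD p 0).testBit q) &&
  (((List.range (2 ^ n)).all fun m => (List.range n).any fun x => (List.range n).any fun y =>
    monoArc R m n n x y && (monoArc R m n n y x || (List.range n).any fun z =>
      monoArc R m n n y z && monoArc R m n n z x)) &&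
  ((List.range n).all fun p => (List.range n).all fun q => !(R.getD p 0).testBit q ||
    masks.any fun m => ((peel (monoArc R m p q))^[n] (List.range n)).isEmpty))

theorem acyclic_of_peel {n k : ℕ} {B : Fin n → Fin n → Prop} {b : ℕ → ℕ → Bool}
    (hb : ∀ i j : Fin n, B i j → b i j = true) (h : ((peel b)^[k] (List.range n)).isEmpty) :
    AcyclicRel B := by
  intro v hv
  have key : ∀ w, Relation.TransGen B v w → w.val ∈ (peel b)^[k] (List.range n) := by
    clear h
    induction k with
    | zero => exact fun w _ => List.mem_range.2 w.2
    | succ k ih =>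
      intro w hw
      rw [Function.iterate_succ_apply', peel, List.mem_filter, List.any_eq_true]
      refine ⟨ih w hw, ?_⟩
      cases hw with
      | single h => exact ⟨v, ih v hv, hb _ _ h⟩
      | tail h1 h2 => exact ⟨_, ih _ h1, hb _ _ h2⟩
  simpa [List.isEmpty_iff.1 h] using key v hv

theorem dicritical_of_isCritical {n : ℕ} {H : SimpleDigraph (Fin n)} {R masks : List ℕ}
    (hR : ∀ i j : Fin n, H.Adj i j ↔ (R.getD i 0).testBit j = true)
    (h : isCritical n R masks = true) : H.Dicritical3 := by
  simp only [isCritical, Bool.and_eq_true, Bool.or_eq_true, List.all_eq_true, List.any_eq_true,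
    List.mem_range, Bool.not_eq_true'] at h
  obtain ⟨hout, hnot, hdel⟩ := h
  constructor
  · rintro ⟨ψ, hψ⟩
    have hm : Bits n (upto (fun i s => sel (decide (∃ v : Fin n, v.val = i ∧ ψ v = 1))
        (setBit s i) s) 0 n) fun i => decide (∃ v : Fin n, v.val = i ∧ ψ v = 1) :=
      upto_setBit _ fun _ _ _ => rfl
    set m := upto (fun i s => sel (decide (∃ v : Fin n, v.val = i ∧ ψ v = 1)) (setBit s i) s) 0 n
    have hbit : ∀ v : Fin n, m.testBit v = decide (ψ v = 1) := fun v => by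
      rw [hm.apply v.2, decide_eq_decide]
      exact ⟨fun ⟨w, hw, h⟩ => Fin.ext hw ▸ h, fun h => ⟨v, rfl, h⟩⟩
    have harc : ∀ i j, (hi : i < n) → (hj : j < n) → monoArc R m n n i j = true →
        H.Adj ⟨i, hi⟩ ⟨j, hj⟩ ∧ ψ ⟨j, hj⟩ = ψ ⟨i, hi⟩ := fun i j hi hj h => by
      simp only [monoArc, Bool.and_eq_true, beq_iff_eq] at h
      refine ⟨(hR _ _).2 h.1, ?_⟩
      have h' := h.2.1
      rw [hbit ⟨i, hi⟩, hbit ⟨j, hj⟩, decide_eq_decide] at h'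
      omega
    obtain ⟨x, hx, y, hy, hxy, h⟩ := hnot m hm.lt
    obtain ⟨a1, e1⟩ := harc x y hx hy hxy
    have s1 : Relation.TransGen (fun a b => H.Adj a b ∧ ψ a = ψ ⟨x, hx⟩ ∧ ψ b = ψ ⟨x, hx⟩)
      ⟨x, hx⟩ ⟨y, hy⟩ := .single ⟨a1, rfl, e1⟩
    refine hψ (ψ ⟨x, hx⟩) ⟨x, hx⟩ ?_
    rcases h with h | ⟨z, hz, hyz, hzx⟩
    · exact s1.tail ⟨(harc y x hy hx h).1, e1, rfl⟩
    · obtain ⟨a2, e2⟩ := harc y z hy hz hyz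
      exact (s1.tail ⟨a2, e1, e2.trans e1⟩).tail ⟨(harc z x hz hx hzx).1, e2.trans e1, rfl⟩
  · intro S A hA hne
    obtain ⟨p, q, hpq, hApq⟩ : ∃ p q, H.Adj p q ∧ ¬ A p q := by
      by_contra! hall
      rcases hne with hS | hA'
      · obtain ⟨v, hv⟩ := (Set.ne_univ_iff_exists_notMem S).1 hS
        obtain ⟨w, hw, hvw⟩ := hout v v.2
        exact hv (hA _ _ (hall v ⟨w, hw⟩ ((hR _ _).2 hvw))).1
      · exact hA' (funext₂ fun u v => propext ⟨fun h => (hA u v h).2.2, hall u v⟩)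
    obtain ⟨m, -, hm⟩ := (hdel p p.2 q q.2).resolve_left (by rw [(hR p q).1 hpq]; decide)
    have hcol : ∀ (i : Fin 2) (u v : Fin n), (if m.testBit u then (1 : Fin 2) else 0) = i →
        (if m.testBit v then (1 : Fin 2) else 0) = i → m.testBit u = m.testBit v := by
      rintro _ u v rfl h
      cases hu : m.testBit u <;> cases hv : m.testBit v <;> simp_all
    refine ⟨fun v => if m.testBit v then 1 else 0, fun i => acyclic_of_peel (fun u v h => ?_) hm⟩
    rw [monoArc, (hR u v).1 (hA u v h.1).2.2, hcol i u v h.2.1 h.2.2]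
    simp only [BEq.rfl, Bool.true_and, Bool.not_eq_true']
    by_contra huv
    rw [Bool.not_eq_false, Bool.and_eq_true] at huv
    obtain rfl := Fin.ext (Nat.eq_of_beq_eq_true huv.1)
    obtain rfl := Fin.ext (Nat.eq_of_beq_eq_true huv.2)
    exact hApq h.1

theorem iso_of_embeds {V : Type} {D : SimpleDigraph V} (hD : D.Dicritical3) {a : V → V → Bool}
    (ha : ∀ x y, a x y = true ↔ D.Adj x y) {n : ℕ} {H : SimpleDigraph (Fin n)} {R : List ℕ}
    (hR : ∀ i j : Fin n, H.Adj i j ↔ (R.getD i 0).testBit j = true) (hlen : R.length = n)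
    (hH : H.Dicritical3) {g : ℕ → V} (hg : Embeds a R g) : D.Iso H := by
  have hg' : ∀ i j : Fin n, i ≠ j → g i ≠ g j ∧ a (g i) (g j) = (R.getD i 0).testBit j :=
    fun i j hij => hg i (hlen ▸ i.2) j (hlen ▸ j.2) fun h => hij (Fin.ext h)
  refine iso_of_embedding hD hH.1 (fun i => g i) (fun i j hij => ?_) fun i j => ?_
  · by_contra hne
    exact (hg' i j hne).1 hij
  · by_cases hij : i = j
    · subst hij
      exact iff_of_false (H.loopless _) (D.loopless _)
    · rw [hR, ← ha, (hg' i j hij).2]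

/-! ### The eight digraphs -/

theorem adj_biK3 (i j : Fin 3) : biK3.Adj i j ↔ ([6, 5, 3].getD i 0).testBit j = true := by
  unfold biK3
  revert i j
  decide

theorem adj_dirW3 (i j : Fin 4) : dirW3.Adj i j ↔ ([10, 12, 9, 7].getD i 0).testBit j = true := by
  unfold dirW3 digraphOfPairs
  revert i j
  decide +kernel

theorem adj_digraphH5 (i j : Fin 5) :
    digraphH5.Adj i j ↔ ([22, 13, 24, 17, 3].getD i 0).testBit j = true := by
  unfold digraphH5 digraphOfPairs
  revert i j
  decide +kernel

theorem adj_rotK2K2 (i j : Fin 5) :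
    rotK2K2.Adj i j ↔ ([14, 13, 24, 20, 3].getD i 0).testBit j = true := by
  unfold rotK2K2 digraphOfPairs
  revert i j
  decide +kernel

theorem adj_rotK2C3 (i j : Fin 6) :
    rotK2C3.Adj i j ↔ ([30, 29, 40, 48, 36, 3].getD i 0).testBit j = true := by
  unfold rotK2C3 digraphOfPairs
  revert i j
  decide +kernel

theorem adj_rotC3K2 (i j : Fin 6) :
    rotC3K2.Adj i j ↔ ([26, 28, 25, 48, 40, 7].getD i 0).testBit j = true := by
  unfold rotC3K2 digraphOfPairs
  revert i j
  decide +kernel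

theorem adj_rotC3C3 (i j : Fin 7) :
    rotC3C3.Adj i j ↔ ([58, 60, 57, 80, 96, 72, 7].getD i 0).testBit j = true := by
  unfold rotC3C3 digraphOfPairs
  revert i j
  decide +kernel

theorem adj_dirP7 (i j : Fin 7) :
    dirP7.Adj i j ↔ ([22, 44, 88, 49, 98, 69, 11].getD i 0).testBit j = true := by
  unfold dirP7
  revert i j
  decide +kernel

theorem dicritical_biK3 : biK3.Dicritical3 :=
  dicritical_of_isCritical adj_biK3 (masks := [1, 2, 3]) (by decide +kernel)

theorem dicritical_dirW3 : dirW3.Dicritical3 :=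
  dicritical_of_isCritical adj_dirW3 (masks := [3, 5, 6, 7]) (by decide +kernel)

theorem dicritical_digraphH5 : digraphH5.Dicritical3 :=
  dicritical_of_isCritical adj_digraphH5 (masks := [3, 5, 6, 9, 13]) (by decide +kernel)

theorem dicritical_rotK2K2 : rotK2K2.Dicritical3 :=
  dicritical_of_isCritical adj_rotK2K2 (masks := [5, 6, 7, 9, 10, 13]) (by decide +kernel)

theorem dicritical_rotK2C3 : rotK2C3.Dicritical3 :=
  dicritical_of_isCritical adj_rotK2C3 (masks := [7, 13, 14, 21, 22, 25, 26, 29])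
    (by decide +kernel)

theorem dicritical_rotC3K2 : rotC3K2.Dicritical3 :=
  dicritical_of_isCritical adj_rotC3K2 (masks := [11, 13, 14, 15, 19, 21, 22, 25])
    (by decide +kernel)

theorem dicritical_rotC3C3 : rotC3C3.Dicritical3 :=
  dicritical_of_isCritical adj_rotC3C3
    (masks := [15, 27, 29, 30, 43, 45, 46, 51, 53, 54, 57]) (by decide +kernel)

theorem dicritical_dirP7 : dirP7.Dicritical3 :=
  dicritical_of_isCritical adj_dirP7 (masks :=
    [7, 14, 15, 19, 21, 25, 27, 28, 30, 37, 38, 41, 42, 43, 45, 50, 51, 53, 54, 56, 60])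
    (by decide +kernel)

set_option maxRecDepth 100000 in
set_option maxHeartbeats 0 in
theorem exclude_program : exclude targetRows [0, 0, 0, 0, 0, 0] program = true := by
  decide +kernel

end DicriticalSearch

open DicriticalSearch in
/-- A semi-complete digraph is 3-dicritical if and only if it is isomorphic
to one of the eight digraphs `↔K3`, `W3`, `H5`, `R(↔K2,↔K2)`, `R(↔K2,C3)`, `R(C3,↔K2)`,
`R(C3,C3)`, `P7`. -/
theorem dicritical3_semicomplete_characterization
    {V : Type} [Fintype V] (D : SimpleDigraph V) (hsc : D.SemiComplete) :
    D.Dicritical3 ↔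
      D.Iso biK3 ∨ D.Iso dirW3 ∨ D.Iso digraphH5 ∨
      D.Iso rotK2K2 ∨ D.Iso rotK2C3 ∨ D.Iso rotC3K2 ∨ D.Iso rotC3C3 ∨ D.Iso dirP7 := by
  constructor
  · intro hD
    have : Nonempty V := by
      by_contra hV
      exact hD.1 ⟨fun _ => 0, fun _ v => absurd ⟨v⟩ hV⟩
    classical
    obtain ⟨φ, hφ⟩ := exists_critical hsc hD
    obtain ⟨T, hT, g, hg⟩ :=
      exists_embeds hφ exclude_program (by decide +kernel) (by decide +kernel)
    have ha : ∀ x y, decide (D.Adj x y) = true ↔ D.Adj x y := fun x y => decide_eq_true_iff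
    simp only [targetRows, List.mem_cons, List.not_mem_nil, or_false] at hT
    rcases hT with rfl | rfl | rfl | rfl | rfl | rfl | rfl | rfl
    · exact Or.inl (iso_of_embeds hD ha adj_biK3 rfl dicritical_biK3 hg)
    · exact Or.inr (Or.inl (iso_of_embeds hD ha adj_dirW3 rfl dicritical_dirW3 hg))
    · exact .inr (.inr (.inl (iso_of_embeds hD ha adj_digraphH5 rfl dicritical_digraphH5 hg)))
    · exact .inr (.inr (.inr (.inl (iso_of_embeds hD ha adj_rotK2K2 rfl dicritical_rotK2K2 hg))))
    · exact .inr (.inr (.inr (.inr (.inl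
        (iso_of_embeds hD ha adj_rotK2C3 rfl dicritical_rotK2C3 hg)))))
    · exact .inr (.inr (.inr (.inr (.inr (.inl
        (iso_of_embeds hD ha adj_rotC3K2 rfl dicritical_rotC3K2 hg))))))
    · exact .inr (.inr (.inr (.inr (.inr (.inr (.inl
        (iso_of_embeds hD ha adj_rotC3C3 rfl dicritical_rotC3C3 hg)))))))
    · exact .inr (.inr (.inr (.inr (.inr (.inr (.inr
        (iso_of_embeds hD ha adj_dirP7 rfl dicritical_dirP7 hg)))))))
  · rintro (h | h | h | h | h | h | h | h)
    · exact dicritical_biK3.of_iso h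
    · exact dicritical_dirW3.of_iso h
    · exact dicritical_digraphH5.of_iso h
    · exact dicritical_rotK2K2.of_iso h
    · exact dicritical_rotK2C3.of_iso h
    · exact dicritical_rotC3K2.of_iso h
    · exact dicritical_rotC3C3.of_iso h
    · exact dicritical_dirP7.of_iso h
end
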